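/- arXiv:1804.04238 — 7 statements merged into one kernel-verified Lean document; each statement's English description precedes it below -/
import Mathlib

section
/- Let X be an FI-set that is finitely generated in degree ≤ d. Then there exist a finite index set I, integers m_i ≤ d for i ∈ I, subgroups H_i ≤ S_{m_i}, and an integer N such that for every n ≥ N there is an S_n-equivariant bijection X_n ≅ ⊔_{i∈I} S_n/(H_i × S_{n−m_i}), where H_i × S_{n−m_i} is embedded in S_n with H_i permuting {1,…,m_i} and S_{n−m_i} permuting {m_i+1,…,n}. -/
/-- The category `FI` has objects `[n] = {1, …, n}` and morphisms the injections.
An `FI`-set is a functor from `FI` to the category of finite sets.  We record it by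
its values `obj n` (for the object `[n]`, modelled as `Fin n`) together with the
maps induced by injections, subject to functoriality. -/
structure FISet where
  obj : ℕ → Type
  map : ∀ {m n : ℕ}, (Fin m ↪ Fin n) → obj m → obj n
  map_id : ∀ (n : ℕ) (x : obj n), map (Function.Embedding.refl (Fin n)) x = x
  map_comp : ∀ {m n p : ℕ} (f : Fin m ↪ Fin n) (g : Fin n ↪ Fin p) (x : obj m),
      map (f.trans g) x = map g (map f x)
  finite : ∀ n, Finite (obj n)

attribute [instance] FISet.finite

noncomputable instance (X : FISet) (n : ℕ) : Fintype (X.obj n) := Fintype.ofFinite _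

/-- Since `End_FI([n]) = S_n`, each `X_n` is an `S_n`-set. -/
instance FISet.instMulAction (X : FISet) (n : ℕ) : MulAction (Equiv.Perm (Fin n)) (X.obj n) where
  smul σ x := X.map σ.toEmbedding x
  one_smul x := by
    have h : (1 : Equiv.Perm (Fin n)).toEmbedding = Function.Embedding.refl (Fin n) := by
      ext i; rfl
    show X.map (1 : Equiv.Perm (Fin n)).toEmbedding x = x
    rw [h]; exact X.map_id n x
  mul_smul σ τ x := by
    have h : (σ * τ).toEmbedding = (τ.toEmbedding.trans σ.toEmbedding) := by ext i; rfl
    show X.map (σ * τ).toEmbedding x = X.map σ.toEmbedding (X.map τ.toEmbedding x)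
    rw [h]; exact X.map_comp _ _ _

theorem FISet.smul_def (X : FISet) {n : ℕ} (σ : Equiv.Perm (Fin n)) (x : X.obj n) :
    σ • x = X.map σ.toEmbedding x := rfl

/-- An `FI`-set is finitely generated in degree `≤ d` if every element of every `X_n` is in
the image of a transition map from some `X_m` with `m ≤ d`. -/
def FISet.FGDeg (X : FISet) (d : ℕ) : Prop :=
  ∀ (n : ℕ) (x : X.obj n), ∃ (m : ℕ) (_ : m ≤ d) (f : Fin m ↪ Fin n) (y : X.obj m),
    X.map f y = x

/-- An `FI`-set is finitely generated if it is finitely generated in some degree. -/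
def FISet.FG (X : FISet) : Prop := ∃ d, X.FGDeg d

/-- The product of two `FI`-sets, `(X × Y)_n = X_n × Y_n` with the diagonal transition maps. -/
def FISet.prod (X Y : FISet) : FISet where
  obj n := X.obj n × Y.obj n
  map f z := (X.map f z.1, Y.map f z.2)
  map_id n z := by simp [X.map_id, Y.map_id]
  map_comp f g z := by simp [X.map_comp, Y.map_comp]
  finite n := by infer_instance

/-- An `FI`-subset of an `FI`-set `X` is a family of subsets `R n ⊆ X_n` carried into one
another by all the transition maps. -/
def FISet.IsFISubset (X : FISet) (R : ∀ n, Set (X.obj n)) : Prop :=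
  ∀ {m n : ℕ} (f : Fin m ↪ Fin n), ∀ x ∈ R m, X.map f x ∈ R n

/-- The sub-`FI`-set determined by an `FI`-subset. -/
def FISet.subFISet (X : FISet) (R : ∀ n, Set (X.obj n)) (hR : X.IsFISubset R) : FISet where
  obj n := ↥(R n)
  map f x := ⟨X.map f x.1, hR f x.1 x.2⟩
  map_id n x := by simp [Subtype.ext_iff, X.map_id]
  map_comp f g x := by simp [Subtype.ext_iff, X.map_comp]
  finite n := by infer_instance
/-- The identification of `Fin m` with the first `m` elements of `Fin n`. -/
def lowEquiv (m n : ℕ) (h : m ≤ n) : Fin m ≃ {j : Fin n // (j : ℕ) < m} where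
  toFun i := ⟨⟨(i : ℕ), lt_of_lt_of_le i.2 h⟩, i.2⟩
  invFun j := ⟨(j.1 : ℕ), j.2⟩
  left_inv i := rfl
  right_inv j := rfl

/-- The identification of `Fin (n - m)` with the last `n - m` elements of `Fin n`. -/
def highEquiv (m n : ℕ) (h : m ≤ n) : Fin (n - m) ≃ {j : Fin n // ¬ ((j : ℕ) < m)} where
  toFun i := ⟨⟨m + (i : ℕ), by have := i.2; omega⟩, by simp⟩
  invFun j := ⟨(j.1 : ℕ) - m, by have h1 := j.1.2; have h2 := j.2; omega⟩
  left_inv i := by ext; simp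
  right_inv j := by
    have h1 := j.2
    apply Subtype.ext; apply Fin.ext; simp; omega

/-- The subgroup `H × S_{n-m}` of `S_n`, where `H ≤ S_m` permutes `{1, …, m}` and
`S_{n-m}` permutes `{m+1, …, n}`. -/
noncomputable def embedSubgroup {m n : ℕ} (h : m ≤ n) (H : Subgroup (Equiv.Perm (Fin m))) :
    Subgroup (Equiv.Perm (Fin n)) :=
  (H.map (Equiv.Perm.extendDomainHom (lowEquiv m n h))) ⊔
    ((⊤ : Subgroup (Equiv.Perm (Fin (n - m)))).map
      (Equiv.Perm.extendDomainHom (highEquiv m n h)))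

namespace FIProof

open Equiv

/-- The standard image of `x` at level `n`. -/
def up (X : FISet) {k n : ℕ} (h : k ≤ n) (x : X.obj k) : X.obj n := X.map (Fin.castLEEmb h) x

lemma up_up (X : FISet) {k l n : ℕ} (h : k ≤ l) (h' : l ≤ n) (x : X.obj k) :
    up X h' (up X h x) = up X (h.trans h') x := by
  unfold up
  rw [← X.map_comp]
  rfl

lemma up_smul (X : FISet) {k n : ℕ} (h : k ≤ n) (x : X.obj k) (σ : Perm (Fin k))
    (σ' : Perm (Fin n)) (hσ : ∀ i, σ' (Fin.castLE h i) = Fin.castLE h (σ i)) :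
    σ' • up X h x = up X h (σ • x) := by
  unfold up
  rw [X.smul_def, X.smul_def, ← X.map_comp, ← X.map_comp]
  congr 1
  ext i
  have := hσ i
  simp only [Function.Embedding.trans_apply, Fin.castLEEmb_apply, Equiv.coe_toEmbedding, this]

lemma exists_ext {k n : ℕ} (h : k ≤ n) (σ : Perm (Fin k)) :
    ∃ σ' : Perm (Fin n), ∀ i, σ' (Fin.castLE h i) = Fin.castLE h (σ i) :=
  ⟨σ.viaEmbedding (Fin.castLEEmb h), fun i => Perm.viaEmbedding_apply σ (Fin.castLEEmb h) i⟩

lemma exists_perm {m n : ℕ} (f g : Fin m ↪ Fin n) : ∃ σ : Perm (Fin n), ∀ i, σ (f i) = g i := by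
  obtain ⟨σ, hσ⟩ := Perm.exists_extending_pair f g f.injective g.injective
  exact ⟨σ, fun i => by simpa using hσ i⟩

lemma up_surj (X : FISet) {d k n : ℕ} (hX : X.FGDeg d) (hdk : d ≤ k) (h : k ≤ n) (z : X.obj n) :
    ∃ (x : X.obj k) (σ : Perm (Fin n)), σ • up X h x = z := by
  obtain ⟨m, hm, f, y, rfl⟩ := hX n z
  obtain ⟨σ, hσ⟩ := exists_perm (Fin.castLEEmb ((hm.trans hdk).trans h)) f
  refine ⟨up X (hm.trans hdk) y, σ, ?_⟩
  rw [up_up]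
  unfold up
  rw [X.smul_def, ← X.map_comp]
  congr 1
  ext i
  have := hσ i
  simp only [Function.Embedding.trans_apply, Equiv.coe_toEmbedding, this]

lemma stab {α : Type} [Finite α] (N₀ : ℕ) (P : ∀ n, N₀ ≤ n → α → Prop)
    (mono : ∀ n n' (h : N₀ ≤ n) (h' : n ≤ n') a, P n h a → P n' (h.trans h') a) :
    ∃ (N : ℕ) (hN : N₀ ≤ N), ∀ n (hn : N ≤ n) a, P n (hN.trans hn) a → P N hN a := by
  let S : ℕ →o Set α := ⟨fun j => {a | P (N₀ + j) (Nat.le_add_right _ _) a}, by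
    intro i j hij a ha
    exact mono _ _ _ (by omega) a ha⟩
  obtain ⟨j, hj⟩ := WellFoundedGT.monotone_chain_condition S
  refine ⟨N₀ + j, Nat.le_add_right _ _, ?_⟩
  intro n hn a ha
  obtain ⟨k, rfl⟩ := Nat.exists_eq_add_of_le (show N₀ ≤ n by omega)
  have h2 := hj k (by omega)
  have : a ∈ S k := ha
  rw [← h2] at this
  exact this

def Supp (X : FISet) {n : ℕ} (x : X.obj n) (T : Finset ℕ) : Prop :=
  ∀ σ : Perm (Fin n), (∀ i : Fin n, (i : ℕ) ∈ T → σ i = i) → σ • x = x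

lemma Supp.swap {X : FISet} {n : ℕ} {x : X.obj n} {T : Finset ℕ} (h : Supp X x T) {a b : Fin n}
    (ha : (a : ℕ) ∉ T) (hb : (b : ℕ) ∉ T) : Equiv.swap a b • x = x := by
  apply h
  intro i hi
  apply Equiv.swap_apply_of_ne_of_ne
  · rintro rfl; exact ha hi
  · rintro rfl; exact hb hi

lemma supp_of_swap {X : FISet} {n : ℕ} {x : X.obj n} {T : Finset ℕ}
    (h : ∀ a b : Fin n, (a : ℕ) ∉ T → (b : ℕ) ∉ T → a ≠ b → Equiv.swap a b • x = x) :
    Supp X x T := by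
  intro σ hσ
  let S : Set (Perm (Fin n)) :=
    {τ | ∃ a b : Fin n, (a : ℕ) ∉ T ∧ (b : ℕ) ∉ T ∧ a ≠ b ∧ τ = Equiv.swap a b}
  have hS : ∀ f ∈ S, f.IsSwap := by
    rintro f ⟨a, b, -, -, hab, rfl⟩
    exact ⟨a, b, hab, rfl⟩
  have h1 : σ ∈ Subgroup.closure S := by
    rw [_root_.mem_closure_isSwap hS]
    refine ⟨Set.toFinite _, fun i => ?_⟩
    by_cases hi : σ i = i
    · rw [hi]; exact MulAction.mem_orbit_self i
    · refine ⟨⟨Equiv.swap i (σ i), Subgroup.subset_closure ⟨i, σ i, ?_, ?_, Ne.symm hi, rfl⟩⟩, ?_⟩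
      · intro hh; exact hi (hσ i hh)
      · intro hh; exact hi (σ.injective (hσ _ hh))
      · exact Equiv.swap_apply_left _ _
  have h2 : Subgroup.closure S ≤ MulAction.stabilizer (Perm (Fin n)) x := by
    rw [Subgroup.closure_le]
    rintro f ⟨a, b, ha, hb, hab, rfl⟩
    exact h a b ha hb hab
  exact h2 h1

lemma Supp.inter {X : FISet} {n : ℕ} {x : X.obj n} {T₁ T₂ : Finset ℕ} (h₁ : Supp X x T₁)
    (h₂ : Supp X x T₂) (c : Fin n) (hc₁ : (c : ℕ) ∉ T₁) (hc₂ : (c : ℕ) ∉ T₂) :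
    Supp X x (T₁ ∩ T₂) := by
  have key : ∀ a : Fin n, (a : ℕ) ∉ T₁ ∩ T₂ → Equiv.swap a c • x = x := by
    intro a ha
    by_cases h : (a : ℕ) ∈ T₁
    · exact h₂.swap (fun h' => ha (Finset.mem_inter.2 ⟨h, h'⟩)) hc₂
    · exact h₁.swap h hc₁
  apply supp_of_swap
  intro a b ha hb hab
  by_cases hac : a = c
  · subst hac; rw [Equiv.swap_comm]; exact key b hb
  by_cases hbc : b = c
  · subst hbc; exact key a ha
  have : Equiv.swap a b = Equiv.swap a c * Equiv.swap b c * Equiv.swap a c := by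
    rw [Equiv.swap_comm a c]
    exact (Equiv.swap_mul_swap_mul_swap (x := b) (y := c) (z := a) hbc (Ne.symm hab)).symm
  rw [this, mul_smul, mul_smul, key a ha, key b hb, key a ha]

lemma exists_fresh {n : ℕ} (A B : Finset ℕ) (h : A.card + B.card < n) :
    ∃ c : Fin n, (c : ℕ) ∉ A ∧ (c : ℕ) ∉ B := by
  have : ¬ Finset.range n ⊆ A ∪ B := by
    intro hs
    have h1 := Finset.card_le_card hs
    have h2 := Finset.card_union_le A B
    rw [Finset.card_range] at h1
    omega
  obtain ⟨c, hc, hc'⟩ := Finset.not_subset.1 this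
  rw [Finset.mem_union, not_or] at hc'
  exact ⟨⟨c, Finset.mem_range.1 hc⟩, hc'⟩

lemma Supp.up {X : FISet} {n n' : ℕ} {x : X.obj n} {T F : Finset ℕ} (h : n ≤ n')
    (hT : Supp X x T) (hF : Supp X (up X h x) F) (hTF : T ⊆ F) (hFn : F ⊆ Finset.range n)
    (hcard : F.card < n) : Supp X (FIProof.up X h x) T := by
  obtain ⟨c, hc, -⟩ := exists_fresh (n := n) F ∅ (by simpa using hcard)
  have h2 : Supp X (FIProof.up X h x) (T ∪ Finset.Ico n n') := by
    apply supp_of_swap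
    intro a b ha hb hab
    simp only [Finset.mem_union, Finset.mem_Ico, not_or] at ha hb
    have han : (a : ℕ) < n := by have := a.2; omega
    have hbn : (b : ℕ) < n := by have := b.2; omega
    have := hT.swap (a := ⟨a, han⟩) (b := ⟨b, hbn⟩) ha.1 hb.1
    rw [up_smul X h x (Equiv.swap ⟨a, han⟩ ⟨b, hbn⟩) _ _, this]
    intro i
    have ea : a = Fin.castLE h ⟨a, han⟩ := rfl
    have eb : b = Fin.castLE h ⟨b, hbn⟩ := rfl
    have hinj : Function.Injective (Fin.castLE h) := Fin.castLE_injective h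
    rw [hinj.map_swap, ← ea, ← eb]
  have h3 := hF.inter h2 (Fin.castLE h c) hc (by
    simp only [Finset.mem_union, Finset.mem_Ico, not_or]
    refine ⟨fun hh => hc (hTF hh), ?_⟩
    have := c.2
    simp only [Fin.val_castLE]; omega)
  have : F ∩ (T ∪ Finset.Ico n n') = T := by
    ext t
    simp only [Finset.mem_inter, Finset.mem_union, Finset.mem_Ico]
    constructor
    · rintro ⟨h1, h2 | h2⟩
      · exact h2
      · have := Finset.mem_range.1 (hFn h1); omega
    · intro ht; exact ⟨hTF ht, Or.inl ht⟩
  rwa [this] at h3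

lemma exists_supp (X : FISet) {d n : ℕ} (hX : X.FGDeg d) (x : X.obj n) :
    ∃ F : Finset ℕ, F.card ≤ d ∧ F ⊆ Finset.range n ∧
      ∀ n' (h : n ≤ n'), Supp X (up X h x) F := by
  obtain ⟨m, hm, f, y, rfl⟩ := hX n x
  refine ⟨Finset.univ.image (fun i => (f i : ℕ)), ?_, ?_, ?_⟩
  · refine Finset.card_image_le.trans ?_
    simpa using hm
  · intro t ht
    obtain ⟨i, -, rfl⟩ := Finset.mem_image.1 ht
    exact Finset.mem_range.2 (f i).2
  · intro n' h σ hσ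
    unfold FIProof.up
    rw [X.smul_def]
    simp only [← X.map_comp]
    congr 1
    ext i
    have := hσ (Fin.castLE h (f i)) (Finset.mem_image.2 ⟨i, Finset.mem_univ _, rfl⟩)
    simp only [Function.Embedding.trans_apply, Equiv.coe_toEmbedding, Fin.castLEEmb_apply, this]

lemma core (X : FISet) {d N₀ : ℕ} (hX : X.FGDeg d) (hN₀ : 2 * d < N₀) (x : X.obj N₀) :
    ∃ (m : ℕ) (_ : m ≤ d) (H : Subgroup (Perm (Fin m))) (N : ℕ) (hN : N₀ ≤ N),
      ∀ n (hn : N ≤ n) (hmn : m ≤ n), ∃ τ : Perm (Fin n), ∀ σ : Perm (Fin n),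
        σ • (τ • up X (hN.trans hn) x) = τ • up X (hN.trans hn) x ↔
          ∃ h ∈ H, ∀ i : Fin m, σ (Fin.castLE hmn i) = Fin.castLE hmn (h i) := by
  classical
  obtain ⟨F, hFd, hFN, hF⟩ := exists_supp X hX x
  have hex : ∃ k, ∃ T : Finset ℕ, T.card = k ∧ T ⊆ F ∧
      ∃ n, ∃ h : N₀ ≤ n, Supp X (up X h x) T := ⟨_, F, rfl, subset_rfl, N₀, le_rfl, hF _ _⟩
  obtain ⟨T, hTm, hTF, n₁, hn₁, hT₁⟩ := Nat.find_spec hex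
  have hmin : ∀ T' : Finset ℕ, T' ⊆ F → ∀ n (h : N₀ ≤ n), Supp X (up X h x) T' →
      T.card ≤ T'.card := by
    intro T' h1 n h h2
    rw [hTm]
    exact Nat.find_min' hex ⟨T', rfl, h1, n, h, h2⟩
  clear hTm
  have hTd : T.card ≤ d := (Finset.card_le_card hTF).trans hFd
  have hT : ∀ n (h : n₁ ≤ n), Supp X (up X (hn₁.trans h) x) T := by
    intro n h
    have := Supp.up (F := F) h hT₁ (by rw [up_up]; exact hF _ _) hTF
      (hFN.trans (Finset.range_subset_range.2 hn₁)) (by omega)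
    rwa [up_up] at this
  -- the embedding with image T
  have hTn : ∀ n, n₁ ≤ n → ∀ i : Fin T.card, T.orderEmbOfFin rfl i < n := by
    intro n hn i
    have := Finset.mem_range.1 (hFN (hTF (Finset.orderEmbOfFin_mem T rfl i)))
    omega
  let g : ∀ n, n₁ ≤ n → Fin T.card ↪ Fin n := fun n hn =>
    ⟨fun i => ⟨T.orderEmbOfFin rfl i, hTn n hn i⟩, fun i j hij => by
      simpa using hij⟩
  have gT : ∀ n hn i, ((g n hn i : Fin n) : ℕ) ∈ T := fun n hn i =>
    Finset.orderEmbOfFin_mem T rfl i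
  have gsurj : ∀ n hn (j : Fin n), (j : ℕ) ∈ T → ∃ i, g n hn i = j := by
    intro n hn j hj
    have : (j : ℕ) ∈ Set.range (T.orderEmbOfFin rfl) := by
      rw [Finset.range_orderEmbOfFin]; exact hj
    obtain ⟨i, hi⟩ := this
    exact ⟨i, Fin.ext hi⟩
  have gup : ∀ n n' hn (h : n ≤ n') i, g n' (hn.trans h) i = Fin.castLE h (g n hn i) :=
    fun _ _ _ _ _ => rfl
  -- invariance of T
  have hinv : ∀ n (hn : n₁ ≤ n) (σ : Perm (Fin n)),
      σ • up X (hn₁.trans hn) x = up X (hn₁.trans hn) x →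
      ∃ h : Perm (Fin T.card), ∀ i, σ (g n hn i) = g n hn (h i) := by
    intro n hn σ hσ
    let T' : Finset ℕ := Finset.univ.image (fun i => (σ (g n hn i) : ℕ))
    have hT'card : T'.card ≤ T.card := Finset.card_image_le.trans (by simp)
    have hT' : Supp X (up X (hn₁.trans hn) x) T' := by
      intro ρ hρ
      have h1 := hT n hn (σ⁻¹ * ρ * σ) (by
        intro j hj
        obtain ⟨i, rfl⟩ := gsurj n hn j hj
        have := hρ (σ (g n hn i)) (Finset.mem_image.2 ⟨i, Finset.mem_univ _, rfl⟩)
        simp [this])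
      rw [mul_smul, mul_smul, hσ, inv_smul_eq_iff, hσ] at h1
      exact h1
    obtain ⟨c, hc, hc'⟩ := exists_fresh (n := n) T T' (by omega)
    have h2 := hmin _ (Finset.inter_subset_left.trans hTF) n _ ((hT n hn).inter hT' c hc hc')
    have h3 : T ∩ T' = T := Finset.eq_of_subset_of_card_le Finset.inter_subset_left h2
    have h4 : T = T' := Finset.eq_of_subset_of_card_le (Finset.inter_eq_left.1 h3) hT'card
    have h5 : ∀ i, ∃ j, g n hn j = σ (g n hn i) := by
      intro i
      apply gsurj n hn
      apply h4.symm.subset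
      exact Finset.mem_image.2 ⟨i, Finset.mem_univ _, rfl⟩
    choose h hh using h5
    have hinj : Function.Injective h := by
      intro i j hij
      have := hh i
      rw [hij, hh j] at this
      exact ((g n hn).injective (σ.injective this)).symm
    exact ⟨Equiv.ofBijective h (Finite.injective_iff_bijective.1 hinj), fun i => (hh i).symm⟩
  let Q : ∀ n, n₁ ≤ n → Perm (Fin T.card) → Prop := fun n hn h =>
    ∃ σ : Perm (Fin n), σ • up X (hn₁.trans hn) x = up X (hn₁.trans hn) x ∧
      ∀ i, σ (g n hn i) = g n hn (h i)
  have Qmono : ∀ n n' (h : n₁ ≤ n) (h' : n ≤ n') a, Q n h a → Q n' (h.trans h') a := by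
    rintro n n' h h' a ⟨σ, h1, h2⟩
    obtain ⟨σ', hσ'⟩ := exists_ext h' σ
    refine ⟨σ', ?_, ?_⟩
    · rw [← up_up X (hn₁.trans h) h', up_smul X h' _ σ σ' hσ', h1]
    · intro i
      rw [gup n n' h h', gup n n' h h', hσ', h2]
  obtain ⟨N, hN, hstab⟩ := stab n₁ Q Qmono
  let H : Subgroup (Perm (Fin T.card)) :=
    { carrier := {h | Q N hN h}
      one_mem' := ⟨1, by simp, by simp⟩
      mul_mem' := by
        rintro a b ⟨σ, h1, h2⟩ ⟨τ, h3, h4⟩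
        exact ⟨σ * τ, by rw [mul_smul, h3, h1], fun i => by simp [h2, h4]⟩
      inv_mem' := by
        rintro a ⟨σ, h1, h2⟩
        refine ⟨σ⁻¹, by rw [inv_smul_eq_iff, h1], fun i => ?_⟩
        rw [Perm.inv_eq_iff_eq, h2]; simp }
  refine ⟨T.card, hTd, H, N, hn₁.trans hN, ?_⟩
  intro n hn hmn
  have hn' : n₁ ≤ n := hN.trans hn
  have main : ∀ σ : Perm (Fin n), σ • up X (hn₁.trans hn') x = up X (hn₁.trans hn') x ↔
      ∃ h ∈ H, ∀ i, σ (g n hn' i) = g n hn' (h i) := by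
    intro σ
    constructor
    · intro hσ
      obtain ⟨h, hh⟩ := hinv n hn' σ hσ
      exact ⟨h, hstab n hn h ⟨σ, hσ, hh⟩, hh⟩
    · rintro ⟨h, hH, hh⟩
      obtain ⟨σ', h1, h2⟩ := Qmono N n hN hn h hH
      have h3 := hT n hn' (σ'⁻¹ * σ) (by
        intro j hj
        obtain ⟨i, rfl⟩ := gsurj n hn' j hj
        rw [Perm.mul_apply, Perm.inv_eq_iff_eq, h2, hh])
      rw [mul_smul, inv_smul_eq_iff, h1] at h3
      exact h3
  obtain ⟨τ, hτ⟩ := exists_perm (Fin.castLEEmb hmn) (g n hn')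
  refine ⟨τ⁻¹, fun σ => ?_⟩
  have h1 := main (τ * σ * τ⁻¹)
  rw [← smul_smul, ← smul_smul, ← eq_inv_smul_iff] at h1
  rw [h1]
  have key : ∀ h : Perm (Fin T.card), (∀ i, (τ * σ * τ⁻¹) (g n hn' i) = g n hn' (h i)) ↔
      ∀ i, σ (Fin.castLE hmn i) = Fin.castLE hmn (h i) := by
    intro h
    refine forall_congr' fun i => ?_
    rw [← hτ, ← hτ]
    simp
  simp only [key]

lemma mem_embed {m n : ℕ} (hmn : m ≤ n) (H : Subgroup (Perm (Fin m))) (σ : Perm (Fin n)) :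
    σ ∈ embedSubgroup hmn H ↔
      ∃ h ∈ H, ∀ i : Fin m, σ (Fin.castLE hmn i) = Fin.castLE hmn (h i) := by
  have low : ∀ (h : Perm (Fin m)) (i : Fin m),
      (h.extendDomain (lowEquiv m n hmn)) (Fin.castLE hmn i) = Fin.castLE hmn (h i) := by
    intro h i
    exact Perm.extendDomain_apply_image h (lowEquiv m n hmn) i
  constructor
  · let K : Subgroup (Perm (Fin n)) :=
      { carrier := {σ | ∃ h ∈ H, ∀ i : Fin m, σ (Fin.castLE hmn i) = Fin.castLE hmn (h i)}
        one_mem' := ⟨1, H.one_mem, by simp⟩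
        mul_mem' := by
          rintro a b ⟨h, h1, h2⟩ ⟨k, h3, h4⟩
          exact ⟨h * k, H.mul_mem h1 h3, fun i => by simp [h2, h4]⟩
        inv_mem' := by
          rintro a ⟨h, h1, h2⟩
          refine ⟨h⁻¹, H.inv_mem h1, fun i => ?_⟩
          rw [Perm.inv_eq_iff_eq, h2]; simp }
    have : embedSubgroup hmn H ≤ K := by
      refine sup_le ?_ ?_
      · rintro _ ⟨h, hh, rfl⟩
        exact ⟨h, hh, low h⟩
      · rintro _ ⟨k, -, rfl⟩
        refine ⟨1, H.one_mem, fun i => ?_⟩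
        exact Perm.extendDomain_apply_not_subtype k (highEquiv m n hmn) (by simp)
    exact fun h => this h
  · rintro ⟨h, hH, hh⟩
    let ρ := (h.extendDomain (lowEquiv m n hmn))⁻¹ * σ
    have hρ : ∀ j : Fin n, (j : ℕ) < m → ρ j = j := by
      intro j hj
      have : j = Fin.castLE hmn ⟨j, hj⟩ := rfl
      rw [this, Perm.mul_apply, hh, Perm.inv_eq_iff_eq, low]
    have hρ2 : ∀ j : Fin n, ¬ ((ρ j : Fin n) : ℕ) < m ↔ ¬ (j : ℕ) < m := by
      intro j
      rw [not_iff_not]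
      constructor
      · intro hj
        have := ρ.injective (hρ _ hj)
        rwa [this] at hj
      · intro hj
        rwa [hρ j hj]
    have hσ : σ = h.extendDomain (lowEquiv m n hmn) *
        ((highEquiv m n hmn).symm.permCongr (ρ.subtypePerm hρ2)).extendDomain
          (highEquiv m n hmn) := by
      rw [← inv_mul_eq_iff_eq_mul]
      change ρ = _
      ext j : 1
      by_cases hj : (j : ℕ) < m
      · rw [hρ j hj, Perm.extendDomain_apply_not_subtype _ _ (by simpa using hj)]
      · rw [Perm.extendDomain_apply_subtype (p := fun j : Fin n => ¬ (j : ℕ) < m) _ _ hj]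
        simp
    rw [hσ]
    exact Subgroup.mul_mem_sup ⟨h, hH, rfl⟩ ⟨_, trivial, rfl⟩

end FIProof

/-- Theorem A: if `X` is an `FI`-set finitely generated in degree `≤ d`,
then there are finitely many integers `mᵢ ≤ d` and subgroups `Hᵢ ≤ S_{mᵢ}` such that for all
sufficiently large `n` there is an `S_n`-equivariant bijection
`X_n ≅ ⊔ᵢ S_n / (Hᵢ × S_{n - mᵢ})`. -/
theorem statement0 (X : FISet) (d : ℕ) (hX : X.FGDeg d) :
    ∃ (s : ℕ) (m : Fin s → ℕ) (hm : ∀ i, m i ≤ d)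
      (H : ∀ i, Subgroup (Equiv.Perm (Fin (m i)))) (N : ℕ) (hNd : d ≤ N),
      ∀ (n : ℕ) (hn : N ≤ n),
        ∃ e : X.obj n ≃
            (Σ i : Fin s, Equiv.Perm (Fin n) ⧸ embedSubgroup ((hm i).trans (hNd.trans hn)) (H i)),
          ∀ (σ : Equiv.Perm (Fin n)) (x : X.obj n),
            e (σ • x) = ⟨(e x).1, σ • (e x).2⟩ := by
  classical
  let N₀ := 2 * d + 1
  have hN₀d : d ≤ N₀ := by omega
  choose m' hm' H' N' hN' hcore using fun x => FIProof.core X hX (N₀ := N₀) (by omega) x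
  let R : ∀ n, N₀ ≤ n → X.obj N₀ × X.obj N₀ → Prop := fun n h p =>
    ∃ σ : Equiv.Perm (Fin n), σ • FIProof.up X h p.1 = FIProof.up X h p.2
  have Rmono : ∀ n n' (h : N₀ ≤ n) (h' : n ≤ n') a, R n h a → R n' (h.trans h') a := by
    rintro n n' h h' a ⟨σ, h1⟩
    obtain ⟨σ', hσ'⟩ := FIProof.exists_ext h' σ
    refine ⟨σ', ?_⟩
    rw [← FIProof.up_up X h h', FIProof.up_smul X h' _ σ σ' hσ', h1, FIProof.up_up]
  obtain ⟨N₁, hN₁, hR⟩ := FIProof.stab N₀ R Rmono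
  let st : Setoid (X.obj N₀) :=
    { r := fun a b => R N₁ hN₁ (a, b)
      iseqv :=
        { refl := fun a => ⟨1, one_smul _ _⟩
          symm := by
            rintro a b ⟨σ, h⟩
            exact ⟨σ⁻¹, by rw [inv_smul_eq_iff]; exact h.symm⟩
          trans := by
            rintro a b c ⟨σ, h⟩ ⟨τ, h'⟩
            exact ⟨τ * σ, by rw [mul_smul]; exact (congrArg _ h).trans h'⟩ } }
  let Ω := Quotient st
  obtain ⟨s, ⟨eΩ⟩⟩ := Finite.exists_equiv_fin Ω
  let r : Fin s → X.obj N₀ := fun i => (eΩ.symm i).out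
  obtain ⟨N₂, hN₂⟩ : ∃ N₂, ∀ x, N' x ≤ N₂ := by
    obtain ⟨B, hB⟩ := (Set.finite_range N').bddAbove
    exact ⟨B, fun x => hB ⟨x, rfl⟩⟩
  refine ⟨s, fun i => m' (r i), fun i => hm' _, fun i => H' (r i), max N₁ N₂,
    (hN₀d.trans hN₁).trans (le_max_left _ _), ?_⟩
  intro n hn
  have hn1 : N₁ ≤ n := (le_max_left _ _).trans hn
  have hn2 : N₂ ≤ n := (le_max_right _ _).trans hn
  have hn0 : N₀ ≤ n := hN₁.trans hn1
  have hmn : ∀ i, m' (r i) ≤ n := fun i => (hm' _).trans (hN₀d.trans hn0)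
  choose τ hτ using fun i => hcore (r i) n ((hN₂ _).trans hn2) (hmn i)
  let z : Fin s → X.obj n := fun i => τ i • FIProof.up X hn0 (r i)
  have hz : ∀ i (σ : Equiv.Perm (Fin n)), σ • z i = z i ↔ σ ∈ embedSubgroup (hmn i) (H' (r i)) := by
    intro i σ
    rw [FIProof.mem_embed]
    exact hτ i σ
  let φ : (Σ i : Fin s, Equiv.Perm (Fin n) ⧸ embedSubgroup (hmn i) (H' (r i))) → X.obj n :=
    fun p => Quotient.liftOn' p.2 (fun σ => σ • z p.1) (by
      intro a b hab
      rw [QuotientGroup.leftRel_apply, ← hz, mul_smul, inv_smul_eq_iff] at hab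
      exact hab.symm)
  have φmk : ∀ i (σ : Equiv.Perm (Fin n)), φ ⟨i, (QuotientGroup.mk σ)⟩ = σ • z i := fun _ _ => rfl
  have φeq : ∀ (σ : Equiv.Perm (Fin n)) p, φ ⟨p.1, σ • p.2⟩ = σ • φ p := by
    rintro σ ⟨i, q⟩
    induction q using QuotientGroup.induction_on with
    | H τ => rw [φmk]; exact (mul_smul σ τ (z i))
  have φbij : Function.Bijective φ := by
    constructor
    · rintro ⟨i, q⟩ ⟨j, q'⟩ h
      induction q using QuotientGroup.induction_on with
      | H σ =>
      induction q' using QuotientGroup.induction_on with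
      | H σ' =>
      rw [φmk, φmk] at h
      have hij : i = j := by
        have h1 : R n hn0 (r i, r j) := by
          refine ⟨(τ j)⁻¹ * σ'⁻¹ * σ * τ i, ?_⟩
          rw [mul_smul, mul_smul, mul_smul, inv_smul_eq_iff, inv_smul_eq_iff]
          exact h
        have h2 : st.r (r i) (r j) := hR n hn1 _ h1
        have h3 : (Quotient.mk st (r i)) = Quotient.mk st (r j) := Quotient.sound h2
        simp only [r, Quotient.out_eq] at h3
        exact eΩ.symm.injective h3
      subst hij
      congr 1
      rw [QuotientGroup.eq, ← hz, mul_smul, inv_smul_eq_iff]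
      exact h.symm
    · intro y
      obtain ⟨x, σ, rfl⟩ := FIProof.up_surj X hX hN₀d hn0 y
      let i := eΩ (Quotient.mk st x)
      have h1 : st.r (r i) x := by
        apply Quotient.exact (s := st)
        simp [r, i]
      obtain ⟨ρ, hρ⟩ := Rmono N₁ n hN₁ hn1 _ h1
      refine ⟨⟨i, QuotientGroup.mk (σ * ρ * (τ i)⁻¹)⟩, ?_⟩
      rw [φmk, mul_smul, mul_smul, inv_smul_smul]
      exact congrArg _ hρ
  refine ⟨(Equiv.ofBijective φ φbij).symm, ?_⟩
  intro σ x
  rw [Equiv.symm_apply_eq, Equiv.ofBijective_apply, φeq]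
  congr 1
  exact ((Equiv.ofBijective φ φbij).apply_symm_apply x).symm
end

section
/- Let X be a finitely generated FI-set and let R be an FI-subset of X × X, with induced maps r_n : ℚX_n → ℚX_n given by r_n(e_x) = Σ_{(x,y) ∈ R_n} e_y. Then there exist an integer n₀, a natural number s, nonzero polynomials P_1,…,P_s ∈ ℚ[t][z], functions f_1,…,f_s : ℕ → ℂ, and polynomials q_1,…,q_s ∈ ℚ[t] such that for all n ≥ n₀: (1) P_i(n, f_i(n)) = 0 for each i; (2) the values f_1(n),…,f_s(n) are pairwise distinct and are exactly the distinct eigenvalues of r_n acting on ℂ ⊗ ℚX_n; and (3) the algebraic multiplicity of f_i(n) as an eigenvalue of r_n equals q_i(n). In particular, the number of distinct eigenvalues of r_n is eventually independent of n, each eigenvalue is given by a function algebraic over ℚ(n), and each multiplicity agrees with a polynomial in n. -/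
open scoped Classical in
/-- The `(0,1)`-matrix over `ℂ` encoding the relation `R_n ⊆ X_n × X_n`. -/
noncomputable def relMatC (X : FISet) (R : ∀ n, Set ((X.prod X).obj n)) (n : ℕ) :
    Matrix (X.obj n) (X.obj n) ℂ :=
  fun y x => if (x, y) ∈ R n then 1 else 0

/-- The linear map `r_n : ℂX_n → ℂX_n`, `r_n(e_x) = Σ_{(x,y) ∈ R_n} e_y`, i.e. the map
induced on `ℂ ⊗ ℚX_n` by the relation `R`. -/
noncomputable def relEnd (X : FISet) (R : ∀ n, Set ((X.prod X).obj n)) (n : ℕ) :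
    Module.End ℂ (X.obj n → ℂ) :=
  letI := Classical.decEq (X.obj n)
  Matrix.toLin' (relMatC X R n)

section Helpers

section PA
open Polynomial Filter

def EvRat (a : ℕ → ℚ) : Prop :=
  ∃ p q : ℚ[X], q ≠ 0 ∧ ∀ᶠ n : ℕ in atTop, a n = p.eval (n : ℚ) / q.eval (n : ℚ)

theorem ev_ne {q : ℚ[X]} (hq : q ≠ 0) : ∀ᶠ n : ℕ in atTop, q.eval (n : ℚ) ≠ 0 :=
  tendsto_natCast_atTop_atTop.eventually (Polynomial.eventually_no_roots q hq)

theorem EvRat.poly (p : ℚ[X]) : EvRat (fun n => p.eval (n : ℚ)) :=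
  ⟨p, 1, one_ne_zero, by simp⟩

theorem EvRat.const (c : ℚ) : EvRat (fun _ => c) := by
  simpa using EvRat.poly (C c)

theorem EvRat.congr {a b : ℕ → ℚ} (ha : EvRat a) (h : ∀ᶠ n in atTop, b n = a n) : EvRat b := by
  obtain ⟨p, q, hq, h'⟩ := ha
  refine ⟨p, q, hq, ?_⟩
  filter_upwards [h, h'] with n h1 h2
  rw [h1, h2]

theorem EvRat.add {a b : ℕ → ℚ} (ha : EvRat a) (hb : EvRat b) : EvRat (fun n => a n + b n) := by
  obtain ⟨p, q, hq, h⟩ := ha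
  obtain ⟨p', q', hq', h'⟩ := hb
  refine ⟨p * q' + q * p', q * q', mul_ne_zero hq hq', ?_⟩
  filter_upwards [h, h', ev_ne hq, ev_ne hq'] with n h1 h2 h3 h4
  rw [h1, h2, eval_add, eval_mul, eval_mul, eval_mul, div_add_div _ _ h3 h4]

theorem EvRat.mul {a b : ℕ → ℚ} (ha : EvRat a) (hb : EvRat b) : EvRat (fun n => a n * b n) := by
  obtain ⟨p, q, hq, h⟩ := ha
  obtain ⟨p', q', hq', h'⟩ := hb
  refine ⟨p * p', q * q', mul_ne_zero hq hq', ?_⟩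
  filter_upwards [h, h'] with n h1 h2
  rw [h1, h2, eval_mul, eval_mul, div_mul_div_comm]

theorem EvRat.neg {a : ℕ → ℚ} (ha : EvRat a) : EvRat (fun n => - a n) := by
  simpa using (EvRat.const (-1)).mul ha

theorem EvRat.zero_or {a : ℕ → ℚ} (ha : EvRat a) :
    (∀ᶠ n in atTop, a n = 0) ∨ (∀ᶠ n in atTop, a n ≠ 0) := by
  obtain ⟨p, q, hq, h⟩ := ha
  by_cases hp : p = 0
  · left
    filter_upwards [h] with n h1
    simp [h1, hp]
  · right
    filter_upwards [h, ev_ne hq, ev_ne hp] with n h1 h2 h3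
    rw [h1]; exact div_ne_zero h3 h2

theorem EvRat.inv {a : ℕ → ℚ} (ha : EvRat a) : EvRat (fun n => (a n)⁻¹) := by
  obtain ⟨p, q, hq, h⟩ := ha
  by_cases hp : p = 0
  · refine (EvRat.const 0).congr ?_
    filter_upwards [h] with n h1
    simp [h1, hp]
  · refine ⟨q, p, hp, ?_⟩
    filter_upwards [h] with n h1
    rw [h1, inv_div]

theorem EvRat.sum {ι : Type*} (s : Finset ι) {a : ι → ℕ → ℚ} (h : ∀ i ∈ s, EvRat (a i)) :
    EvRat (fun n => ∑ i ∈ s, a i n) := by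
  classical
  induction s using Finset.induction_on with
  | empty => simpa using EvRat.const 0
  | insert i s hi ih =>
    simp only [Finset.sum_insert hi]
    exact (h i (by simp)).add (ih fun j hj => h j (by simp [hj]))

def evRatSubring : Subring (ℕ → ℚ) where
  carrier := {a | EvRat a}
  mul_mem' ha hb := EvRat.mul ha hb
  one_mem' := EvRat.const 1
  add_mem' ha hb := EvRat.add ha hb
  zero_mem' := EvRat.const 0
  neg_mem' ha := EvRat.neg ha

def evAt (n : ℕ) : evRatSubring →+* ℚ := (Pi.evalRingHom (fun _ : ℕ => ℚ) n).comp evRatSubring.subtype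

section mat
variable {ι : Type*} [Fintype ι] [DecidableEq ι]

def EvMat (M : ℕ → Matrix ι ι ℚ) : Prop := ∀ i j, EvRat (fun n => M n i j)

def EvMat.lift {M : ℕ → Matrix ι ι ℚ} (h : EvMat M) : Matrix ι ι evRatSubring :=
  fun i j => ⟨fun n => M n i j, h i j⟩

theorem EvMat.lift_map {M : ℕ → Matrix ι ι ℚ} (h : EvMat M) (n : ℕ) :
    h.lift.map (evAt n) = M n := rfl

theorem EvMat.charpoly {M : ℕ → Matrix ι ι ℚ} (h : EvMat M) (k : ℕ) :
    EvRat (fun n => (M n).charpoly.coeff k) := by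
  have : ∀ n, (M n).charpoly.coeff k = (h.lift.charpoly.coeff k).1 n := by
    intro n
    rw [← h.lift_map n, Matrix.charpoly_map, coeff_map]
    rfl
  simp only [this]
  exact (h.lift.charpoly.coeff k).2

theorem EvMat.det {M : ℕ → Matrix ι ι ℚ} (h : EvMat M) :
    EvRat (fun n => (M n).det) := by
  have : ∀ n, (M n).det = (h.lift.det).1 n := by
    intro n
    rw [← h.lift_map n, ← RingHom.mapMatrix_apply, ← RingHom.map_det]
    rfl
  simp only [this]
  exact (h.lift.det).2

theorem EvMat.adjugate {M : ℕ → Matrix ι ι ℚ} (h : EvMat M) :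
    EvMat (fun n => (M n).adjugate) := by
  intro i j
  have : ∀ n, (M n).adjugate i j = (h.lift.adjugate i j).1 n := by
    intro n
    rw [← h.lift_map n, ← RingHom.mapMatrix_apply, ← RingHom.map_adjugate]
    rfl
  simp only [this]
  exact (h.lift.adjugate i j).2

theorem EvMat.mul {M N : ℕ → Matrix ι ι ℚ} (h : EvMat M) (h' : EvMat N) :
    EvMat (fun n => M n * N n) := by
  intro i j
  simp only [Matrix.mul_apply]
  exact EvRat.sum _ fun k _ => (h i k).mul (h' k j)

theorem EvMat.one : EvMat (fun _ => (1 : Matrix ι ι ℚ)) := fun i j => EvRat.const _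

theorem EvMat.pow {M : ℕ → Matrix ι ι ℚ} (h : EvMat M) (k : ℕ) :
    EvMat (fun n => M n ^ k) := by
  induction k with
  | zero => simpa using EvMat.one
  | succ k ih => simp only [pow_succ]; exact ih.mul h

theorem EvMat.trace {M : ℕ → Matrix ι ι ℚ} (h : EvMat M) :
    EvRat (fun n => (M n).trace) := EvRat.sum _ fun k _ => h k k

theorem EvMat.inv {M : ℕ → Matrix ι ι ℚ} (h : EvMat M) :
    EvMat (fun n => (M n)⁻¹) := by
  intro i j
  simp only [Matrix.inv_def, Matrix.smul_apply, smul_eq_mul, Ring.inverse_eq_inv']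
  exact (h.det.inv).mul (h.adjugate i j)
end mat

/-- a sequence of polynomials of bounded degree with eventually rational coefficients -/
theorem clear_denoms (s : ℕ) (g : ℕ → ℚ[X]) (hd : ∀ᶠ n in atTop, (g n).natDegree ≤ s)
    (h0 : ∀ᶠ n in atTop, g n ≠ 0)
    (hg : ∀ k, EvRat (fun n => (g n).coeff k)) :
    ∃ (P : ℚ[X][X]) (c : ℚ[X]), P ≠ 0 ∧ c ≠ 0 ∧ ∀ᶠ n : ℕ in atTop,
      P.map (evalRingHom (n : ℚ)) = C (c.eval (n : ℚ)) * g n := by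
  choose p q hq h using hg
  let c : ℚ[X] := ∏ k ∈ Finset.range (s + 1), q k
  have hc : c ≠ 0 := Finset.prod_ne_zero_iff.2 fun k _ => hq k
  let P : ℚ[X][X] := ∑ k ∈ Finset.range (s + 1),
    C (p k * ∏ j ∈ (Finset.range (s + 1)).erase k, q j) * X ^ k
  have key : ∀ᶠ n : ℕ in atTop, P.map (evalRingHom (n : ℚ)) = C (c.eval (n : ℚ)) * g n := by
    have h1 : ∀ᶠ n : ℕ in atTop, ∀ k ∈ Finset.range (s+1),
        (g n).coeff k = (p k).eval (n : ℚ) / (q k).eval (n : ℚ) ∧ (q k).eval (n : ℚ) ≠ 0 :=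
      (Filter.eventually_all_finset _).2 fun k _ => (h k).and (ev_ne (hq k))
    filter_upwards [h1, hd] with n h1 h2
    have : g n = ∑ k ∈ Finset.range (s + 1), C ((g n).coeff k) * X ^ k := by
      conv_lhs => rw [as_sum_range_C_mul_X_pow' (g n) (Nat.lt_succ_of_le h2)]
    rw [this, Finset.mul_sum]
    simp only [P, Polynomial.map_sum]
    refine Finset.sum_congr rfl fun k hk => ?_
    rw [Polynomial.map_mul, Polynomial.map_pow, map_X, map_C, ← mul_assoc, ← C_mul]
    congr 2
    rw [(h1 k hk).1, coe_evalRingHom, eval_mul]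
    have : c = q k * ∏ j ∈ (Finset.range (s + 1)).erase k, q j := 
      (Finset.mul_prod_erase _ _ hk).symm
    rw [this, eval_mul]
    have := (h1 k hk).2
    field_simp
  refine ⟨P, c, ?_, hc, key⟩
  rintro hP
  obtain ⟨n, h1, h2, h3⟩ := (key.and (h0.and (ev_ne hc))).exists
  rw [hP, Polynomial.map_zero] at h1
  exact mul_ne_zero (C_ne_zero.2 h3) h2 h1.symm
end PA

section PB1
open Polynomial Filter

/-- evaluation of a bivariate rational polynomial at a point of an algebra -/
noncomputable def spec (K : Type*) [Field K] [Algebra ℚ K] (x : K) : ℚ[X] →+* K :=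
  eval₂RingHom (algebraMap ℚ K) x

noncomputable def e {K : Type*} [Field K] [Algebra ℚ K] (U : ℚ[X][X]) (x y : K) : K :=
  (U.map (spec K x)).eval y

section
variable {K : Type*} [Field K] [Algebra ℚ K]
theorem e_add (U V : ℚ[X][X]) (x y : K) : e (U + V) x y = e U x y + e V x y := by simp [e]
theorem e_mul (U V : ℚ[X][X]) (x y : K) : e (U * V) x y = e U x y * e V x y := by simp [e]
theorem e_sub (U V : ℚ[X][X]) (x y : K) : e (U - V) x y = e U x y - e V x y := by simp [e]
theorem e_C (c : ℚ[X]) (x y : K) : e (C c) x y = spec K x c := by simp [e]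
theorem e_X (x y : K) : e X x y = y := by simp [e]
theorem e_one (x y : K) : e 1 x y = 1 := by simp [e]
theorem e_monomial (k : ℕ) (c : ℚ[X]) (x y : K) :
    e (monomial k c) x y = spec K x c * y ^ k := by simp [e]
end

theorem spec_real (x : ℝ) (c : ℚ[X]) : spec ℝ x c = (c.map (algebraMap ℚ ℝ)).eval x := by
  simp [spec, eval_map]

theorem spec_nat (n : ℕ) (c : ℚ[X]) : spec ℝ (n : ℝ) c = ((c.eval (n : ℚ) : ℚ) : ℝ) := by
  rw [spec_real]
  have := Polynomial.eval_map_apply (algebraMap ℚ ℝ) (p := c) (n : ℚ)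
  simpa using this

theorem spec_ofReal (x : ℝ) (c : ℚ[X]) : spec ℂ (x : ℂ) c = ((spec ℝ x c : ℝ) : ℂ) := by
  simp only [spec, coe_eval₂RingHom]
  have := Polynomial.hom_eval₂ c (algebraMap ℚ ℝ) (Complex.ofRealHom) x
  simp only [Complex.ofRealHom_eq_coe] at this
  rw [this]; congr 1

theorem spec_ev_ne {c : ℚ[X]} (hc : c ≠ 0) : ∀ᶠ x : ℝ in atTop, spec ℝ x c ≠ 0 := by
  have : c.map (algebraMap ℚ ℝ) ≠ 0 := (Polynomial.map_ne_zero_iff (algebraMap ℚ ℝ).injective).2 hc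
  filter_upwards [Polynomial.eventually_no_roots _ this] with x hx
  rwa [spec_real]

theorem hasDerivAt_e (U : ℚ[X][X]) : ∃ U1 : ℚ[X][X], ∀ (m : ℝ → ℝ) (m' x : ℝ),
    HasDerivAt m m' x → HasDerivAt (fun t => e U t (m t))
      (e U1 x (m x) + e (derivative U) x (m x) * m') x := by
  induction U using Polynomial.induction_on' with
  | add p q hp hq =>
    obtain ⟨p1, hp⟩ := hp
    obtain ⟨q1, hq⟩ := hq
    refine ⟨p1 + q1, fun m m' x h => ?_⟩
    have := (hp m m' x h).add (hq m m' x h)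
    simp only [derivative_add, e_add]
    convert! this using 1
    ring
  | monomial k c =>
    refine ⟨monomial k (derivative c), fun m m' x h => ?_⟩
    simp only [e_monomial, derivative_monomial, spec_real]
    have h1 := (c.map (algebraMap ℚ ℝ)).hasDerivAt x
    have := h1.mul (h.pow k)
    convert! this using 1
    simp [spec_real, derivative_map]
    ring

theorem contDiff_e (U : ℚ[X][X]) : ContDiff ℝ 1 (fun z : ℝ × ℝ => e U z.1 z.2) := by
  induction U using Polynomial.induction_on' with
  | add p q hp hq => simp only [e_add]; exact hp.add hq
  | monomial k c =>
    simp only [e_monomial, spec_real]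
    have h1 : ContDiff ℝ 1 (fun x : ℝ => (c.map (algebraMap ℚ ℝ)).eval x) := by
      simpa using Polynomial.contDiff_aeval (𝕜 := ℝ) (c.map (algebraMap ℚ ℝ)) 1
    exact (h1.comp contDiff_fst).mul (contDiff_snd.pow k)

theorem continuous_eC (U : ℚ[X][X]) (z : ℂ) : Continuous (fun x : ℝ => e U (x : ℂ) z) := by
  induction U using Polynomial.induction_on' with
  | add p q hp hq => simp only [e_add]; exact hp.add hq
  | monomial k c =>
    simp only [e_monomial, spec_ofReal, spec_real]
    fun_prop

theorem bezout {G U : ℚ[X][X]} (hG : Irreducible G) (hd : 0 < G.natDegree) (hU : ¬ G ∣ U) :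
    ∃ a b : ℚ[X][X], ∃ c : ℚ[X], c ≠ 0 ∧ a * U + b * G = C c := by
  have hprim : G.IsPrimitive := hG.isPrimitive hd.ne'
  let K := FractionRing ℚ[X]
  have hinj : Function.Injective (algebraMap ℚ[X] K) := IsFractionRing.injective _ _
  have hirr : Irreducible (G.map (algebraMap ℚ[X] K)) :=
    (hprim.irreducible_iff_irreducible_map_fraction_map (K := K)).1 hG
  have hnd : ¬ G.map (algebraMap ℚ[X] K) ∣ U.map (algebraMap ℚ[X] K) := by
    intro h
    exact hU ((hprim.dvd_iff_fraction_map_dvd_fraction_map K).2 h)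
  obtain ⟨b, a, hab⟩ := (hirr.coprime_iff_not_dvd).2 hnd
  obtain ⟨ca, ha0, ha⟩ := IsLocalization.integerNormalization_spec (nonZeroDivisors ℚ[X]) a
  obtain ⟨cb, hb0, hb⟩ := IsLocalization.integerNormalization_spec (nonZeroDivisors ℚ[X]) b
  set a' := IsLocalization.integerNormalization (nonZeroDivisors ℚ[X]) a
  set b' := IsLocalization.integerNormalization (nonZeroDivisors ℚ[X]) b
  refine ⟨C cb * a', C ca * b', ca * cb, mul_ne_zero (nonZeroDivisors.ne_zero ha0)
    (nonZeroDivisors.ne_zero hb0), Polynomial.map_injective _ hinj ?_⟩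
  have hs : ∀ (c : ℚ[X]) (p : K[X]), c • p = C (algebraMap ℚ[X] K c) * p := by
    intro c p
    rw [← algebraMap_smul K c p, smul_eq_C_mul]
  simp only [Polynomial.map_add, Polynomial.map_mul, map_C, ha, hb, hs, map_mul, C_mul]
  linear_combination (C ((algebraMap ℚ[X] K) ca) * C ((algebraMap ℚ[X] K) cb)) * hab
end PB1

section PB2
open Polynomial Filter Topology

theorem implicit_root (G : ℚ[X][X]) (x1 r : ℝ) (h0 : e G x1 r = 0)
    (h1 : e (derivative G) x1 r ≠ 0) :
    ∃ g : ℝ → ℝ, g x1 = r ∧ DifferentiableAt ℝ g x1 ∧ ∀ᶠ x in 𝓝 x1, e G x (g x) = 0 := by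
  have cdf : ContDiffAt ℝ 1 (fun z : ℝ × ℝ => e G z.1 z.2) (x1, r) := (contDiff_e G).contDiffAt
  have hder : (fderiv ℝ (fun z : ℝ × ℝ => e G z.1 z.2) (x1, r) ∘L .inr ℝ ℝ ℝ) 1
      = e (derivative G) x1 r := by
    have hf := (cdf.differentiableAt one_ne_zero).hasFDerivAt
    have h2 : HasFDerivAt (fun y : ℝ => ((x1, y) : ℝ × ℝ)) (.inr ℝ ℝ ℝ) r := hasFDerivAt_prodMk_right x1 r
    have h3 := (HasFDerivAt.comp r hf h2).hasDerivAt
    have h4 : HasDerivAt (fun y : ℝ => e G x1 y) (e (derivative G) x1 r) r := by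
      have := (G.map (spec ℝ x1)).hasDerivAt r
      simpa [e, derivative_map] using this
    exact h3.unique h4
  have inv : (fderiv ℝ (fun z : ℝ × ℝ => e G z.1 z.2) (x1, r) ∘L .inr ℝ ℝ ℝ).IsInvertible := by
    refine ⟨ContinuousLinearEquiv.unitsEquivAut ℝ (Units.mk0 _ h1), ?_⟩
    ext
    rw [hder]
    simp
  refine ⟨cdf.implicitFunction one_ne_zero inv, ?_, ?_, ?_⟩
  · exact cdf.implicitFunction_apply_self one_ne_zero inv
  · exact (cdf.contDiffAt_implicitFunction one_ne_zero inv).differentiableAt one_ne_zero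
  · have := cdf.eventually_apply_implicitFunction one_ne_zero inv
    filter_upwards [this] with x hx
    rw [← h0]; exact hx

theorem local_branch (G : ℚ[X][X]) (hd : 0 < G.natDegree) (x0 : ℝ)
    (hlc : ∀ x > x0, spec ℝ x G.leadingCoeff ≠ 0)
    (hsep : ∀ x > x0, ∀ y : ℝ, e G x y = 0 → e (derivative G) x y ≠ 0)
    (x1 : ℝ) (hx1 : x1 > x0) (hs : (G.map (spec ℝ x1)).Splits) :
    (∀ᶠ x in 𝓝 x1, (G.map (spec ℝ x)).Splits) ∧
    e G x1 (sSup {y | e G x1 y = 0}) = 0 ∧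
    DifferentiableAt ℝ (fun x => sSup {y | e G x y = 0}) x1 := by
  classical
  have hdeg : ∀ x > x0, (G.map (spec ℝ x)).natDegree = G.natDegree := fun x hx =>
    natDegree_map_of_leadingCoeff_ne_zero _ (hlc x hx)
  have hne : ∀ x > x0, G.map (spec ℝ x) ≠ 0 := fun x hx h => by
    have := hdeg x hx
    rw [h, natDegree_zero] at this
    omega
  have hmem : ∀ x > x0, ∀ y, y ∈ (G.map (spec ℝ x)).roots ↔ e G x y = 0 := fun x hx y => by
    rw [mem_roots (hne x hx)]; rfl
  have hnodup : ∀ x > x0, (G.map (spec ℝ x)).roots.Nodup := fun x hx => by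
    rw [Multiset.nodup_iff_count_le_one]
    intro y
    by_contra hcon
    push Not at hcon
    rw [count_roots] at hcon
    have h2 := (one_lt_rootMultiplicity_iff_isRoot (hne x hx)).1 hcon
    refine hsep x hx y h2.1 ?_
    have := h2.2
    rwa [derivative_map] at this
  set F : Finset ℝ := (G.map (spec ℝ x1)).roots.toFinset with hF
  have hFcard : F.card = G.natDegree := by
    rw [hF, Multiset.toFinset_card_of_nodup (hnodup x1 hx1), ← hs.natDegree_eq_card_roots,
      hdeg x1 hx1]
  have hFmem : ∀ y, y ∈ F ↔ e G x1 y = 0 := fun y => by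
    rw [hF, Multiset.mem_toFinset, hmem x1 hx1]
  have : ∀ r : ℝ, ∃ g : ℝ → ℝ, r ∈ F → (g x1 = r ∧ DifferentiableAt ℝ g x1 ∧
      ∀ᶠ x in 𝓝 x1, e G x (g x) = 0) := fun r => by
    by_cases hr : r ∈ F
    · obtain ⟨g, hg⟩ := implicit_root G x1 r ((hFmem r).1 hr) (hsep x1 hx1 r ((hFmem r).1 hr))
      exact ⟨g, fun _ => hg⟩
    · exact ⟨id, fun h => absurd h hr⟩
  choose g hg using this
  have hFne : F.Nonempty := Finset.card_pos.1 (by omega)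
  have ev1 : ∀ᶠ x in 𝓝 x1, ∀ r ∈ F, e G x (g r x) = 0 :=
    (Filter.eventually_all_finset _).2 fun r hr => (hg r hr).2.2
  have ev2 : ∀ᶠ x in 𝓝 x1, ∀ r ∈ F, ∀ r' ∈ F, r < r' → g r x < g r' x := by
    refine (Filter.eventually_all_finset _).2 fun r hr => (Filter.eventually_all_finset _).2 fun r' hr' => ?_
    by_cases hlt : r < r'
    · have : g r x1 < g r' x1 := by rw [(hg r hr).1, (hg r' hr').1]; exact hlt
      filter_upwards [(hg r hr).2.1.continuousAt.eventually_lt (hg r' hr').2.1.continuousAt this]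
        with x hx _ using hx
    · exact Eventually.of_forall fun x h => absurd h hlt
  have ev3 : ∀ᶠ x in 𝓝 x1, x > x0 := eventually_gt_nhds hx1
  have key : ∀ᶠ x in 𝓝 x1, (G.map (spec ℝ x)).Splits ∧
      (∀ y, e G x y = 0 ↔ ∃ r ∈ F, g r x = y) := by
    filter_upwards [ev1, ev2, ev3] with x h1 h2 h3
    have hinj : Set.InjOn (fun r => g r x) F := by
      intro r hr r' hr' heq
      rcases lt_trichotomy r r' with h | h | h
      · exact absurd heq (h2 r hr r' hr' h).ne
      · exact h
      · exact absurd heq (h2 r' hr' r hr h).ne'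
    have hsub : F.image (fun r => g r x) ⊆ (G.map (spec ℝ x)).roots.toFinset := by
      intro y hy
      obtain ⟨r, hr, rfl⟩ := Finset.mem_image.1 hy
      rw [Multiset.mem_toFinset, hmem x h3]
      exact h1 r hr
    have hc : (F.image (fun r => g r x)).card = G.natDegree := by
      rw [Finset.card_image_of_injOn hinj, hFcard]
    have hc2 : (G.map (spec ℝ x)).roots.card ≤ G.natDegree := by
      rw [← hdeg x h3]; exact card_roots' _
    have hc3 := Multiset.toFinset_card_le (G.map (spec ℝ x)).roots
    have hc4 := Finset.card_le_card hsub
    have heq := Finset.eq_of_subset_of_card_le hsub (by omega)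
    refine ⟨splits_iff_card_roots.2 (by rw [hdeg x h3]; omega), fun y => ?_⟩
    rw [← hmem x h3, ← Multiset.mem_toFinset, ← heq, Finset.mem_image]
  let M := F.max' hFne
  have hM : M ∈ F := F.max'_mem hFne
  have hsup : ∀ᶠ x in 𝓝 x1, sSup {y | e G x y = 0} = g M x := by
    filter_upwards [key, ev2] with x h1 h2
    apply IsGreatest.csSup_eq
    refine ⟨(h1.2 _).2 ⟨M, hM, rfl⟩, ?_⟩
    intro y hy
    obtain ⟨r, hr, rfl⟩ := (h1.2 y).1 hy
    rcases (F.le_max' r hr).lt_or_eq with h | h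
    · exact (h2 r hr M hM h).le
    · exact (congrArg (fun r => g r x) h).le
  refine ⟨key.mono fun x hx => hx.1, ?_, ?_⟩
  · rw [hsup.self_of_nhds, (hg M hM).1]
    exact (hFmem M).1 hM
  · exact (hg M hM).2.1.congr_of_eventuallyEq hsup

theorem closed_splits (G : ℚ[X][X]) (x0 : ℝ)
    (hlc : ∀ x > x0, spec ℝ x G.leadingCoeff ≠ 0) (x1 : ℝ) (hx1 : x1 > x0)
    (hcl : ∃ᶠ x in 𝓝 x1, (G.map (spec ℝ x)).Splits) : (G.map (spec ℝ x1)).Splits := by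
  have hdeg : ∀ x > x0, (G.map (spec ℝ x)).natDegree = G.natDegree := fun x hx =>
    natDegree_map_of_leadingCoeff_ne_zero _ (hlc x hx)
  have hmap : ∀ x : ℝ, (G.map (spec ℝ x)).map Complex.ofRealHom = G.map (spec ℂ (x : ℂ)) := by
    intro x
    rw [Polynomial.map_map]
    congr 1
    ext c
    · simp
    · simp [spec]
  have hbd : ∀ x > x0, (G.map (spec ℝ x)).Splits → ∀ z : ℂ,
      |spec ℝ x G.leadingCoeff| * |z.im| ^ G.natDegree ≤ ‖e G (x : ℂ) z‖ := by
    intro x hx hs z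
    have h1 := hs.eq_prod_roots
    have hl : (G.map (spec ℝ x)).leadingCoeff = spec ℝ x G.leadingCoeff :=
      leadingCoeff_map_of_leadingCoeff_ne_zero _ (hlc x hx)
    have h2 : e G (x : ℂ) z = ((spec ℝ x G.leadingCoeff : ℝ) : ℂ) *
        ((G.map (spec ℝ x)).roots.map fun r : ℝ => z - (r : ℂ)).prod := by
      rw [e, ← hmap]
      conv_lhs => rw [h1]
      rw [hl, Polynomial.map_mul, Polynomial.map_multiset_prod, eval_mul, eval_multiset_prod,
        Multiset.map_map, Multiset.map_map]
      simp [Function.comp_def]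
    rw [h2, norm_mul, Complex.norm_real, Real.norm_eq_abs]
    refine mul_le_mul_of_nonneg_left ?_ (abs_nonneg _)
    rw [← hdeg x hx, hs.natDegree_eq_card_roots]
    generalize (G.map (spec ℝ x)).roots = S
    induction S using Multiset.induction_on with
    | empty => simp
    | cons a S ih =>
      rw [Multiset.map_cons, Multiset.prod_cons, norm_mul, Multiset.card_cons, pow_succ, mul_comm]
      refine mul_le_mul ?_ ih (by positivity) (by positivity)
      have := Complex.abs_im_le_norm (z - (a : ℂ))
      simpa using this
  have hbd1 : ∀ z : ℂ, |spec ℝ x1 G.leadingCoeff| * |z.im| ^ G.natDegree ≤ ‖e G (x1 : ℂ) z‖ := by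
    intro z
    by_contra hcon
    push Not at hcon
    have c1 : ContinuousAt (fun x : ℝ => ‖e G (x : ℂ) z‖) x1 :=
      (continuous_eC G z).norm.continuousAt
    have c2 : ContinuousAt (fun x : ℝ => |spec ℝ x G.leadingCoeff| * |z.im| ^ G.natDegree) x1 := by
      simp only [spec_real]
      fun_prop
    have := c1.eventually_lt c2 hcon
    obtain ⟨x, h1, h2, h3⟩ := (hcl.and_eventually (this.and (eventually_gt_nhds hx1))).exists
    exact absurd (hbd x h3 h1 z) (not_le.2 h2)
  refine Splits.of_splits_map Complex.ofRealHom (IsAlgClosed.splits _) fun z hz => ?_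
  have hz0 : e G (x1 : ℂ) z = 0 := by
    rw [hmap] at hz
    exact isRoot_of_mem_roots hz
  have := hbd1 z
  rw [hz0, norm_zero] at this
  have h3 : |z.im| ^ G.natDegree ≤ 0 := by
    by_contra hcon
    push Not at hcon
    have : 0 < |spec ℝ x1 G.leadingCoeff| * |z.im| ^ G.natDegree :=
      mul_pos (abs_pos.2 (hlc x1 hx1)) hcon
    linarith
  have h4 : z.im = 0 := by
    by_contra h5
    exact absurd h3 (not_le.2 (pow_pos (abs_pos.2 h5) _))
  exact ⟨z.re, by apply Complex.ext <;> simp [h4]⟩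

theorem branch (G : ℚ[X][X]) (hG : Irreducible G) (hd : 0 < G.natDegree)
    (hs : ∃ᶠ n : ℕ in atTop, (G.map (spec ℝ (n : ℝ))).Splits) :
    ∃ m : ℝ → ℝ, ∀ᶠ x in atTop, e G x (m x) = 0 ∧ DifferentiableAt ℝ m x := by
  have hG0 : G ≠ 0 := hG.ne_zero
  have hder : derivative G ≠ 0 := by
    intro h
    have := natDegree_eq_zero_of_derivative_eq_zero h
    omega
  have hnd : ¬ G ∣ derivative G := fun h => by
    have h1 := natDegree_le_of_dvd h hder
    have h2 := natDegree_derivative_lt hd.ne'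
    omega
  obtain ⟨a, b, c, hc, hab⟩ := bezout hG hd hnd
  obtain ⟨x0, hx0⟩ := eventually_atTop.1 ((spec_ev_ne hc).and
    (spec_ev_ne (leadingCoeff_ne_zero.2 hG0)))
  have hlc : ∀ x > x0, spec ℝ x G.leadingCoeff ≠ 0 := fun x hx => (hx0 x hx.le).2
  have hsep : ∀ x > x0, ∀ y : ℝ, e G x y = 0 → e (derivative G) x y ≠ 0 := by
    intro x hx y h1 h2
    have := congrArg (fun U => e U x y) hab
    simp only [e_add, e_mul, h1, h2, e_C] at this
    exact (hx0 x hx.le).1 (by rw [← this]; ring)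
  have hall : ∀ x > x0, (G.map (spec ℝ x)).Splits := by
    let S : Set ℝ := {x | (G.map (spec ℝ x)).Splits}
    obtain ⟨n, hn, hn2⟩ := (hs.and_eventually
      (tendsto_natCast_atTop_atTop.eventually (eventually_gt_atTop x0))).exists
    have hsub : Set.Ioi x0 ⊆ interior S := by
      refine isPreconnected_Ioi.subset_of_closure_inter_subset isOpen_interior
        ⟨n, hn2, ?_⟩ ?_
      · exact mem_interior_iff_mem_nhds.2 (local_branch G hd x0 hlc hsep n hn2 hn).1
      · rintro x ⟨hx, hx2⟩
        have h1 : (G.map (spec ℝ x)).Splits := closed_splits G x0 hlc x hx2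
          ((mem_closure_iff_frequently.1 hx).mono fun y hy => (interior_subset hy : y ∈ S))
        exact mem_interior_iff_mem_nhds.2 (local_branch G hd x0 hlc hsep x hx2 h1).1
    exact fun x hx => (interior_subset (hsub hx) : x ∈ S)
  refine ⟨fun x => sSup {y | e G x y = 0}, ?_⟩
  filter_upwards [eventually_gt_atTop x0] with x hx
  exact (local_branch G hd x0 hlc hsep x hx (hall x hx)).2
end PB2

section PB3
open Polynomial Filter Topology

theorem spec_bound (c : ℚ[X]) : ∃ (K : ℝ) , 0 ≤ K ∧ ∀ N, c.natDegree ≤ N → ∀ x : ℝ, 1 ≤ x → |spec ℝ x c| ≤ K * x ^ N := by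
  refine ⟨∑ i ∈ Finset.range (c.natDegree + 1), |((c.coeff i : ℚ) : ℝ)|, by positivity, fun N hN x hx => ?_⟩
  rw [spec_real, eval_eq_sum_range' (n := c.natDegree + 1)
    (by have := natDegree_map_le (f := algebraMap ℚ ℝ) (p := c); omega), Finset.sum_mul]
  refine (Finset.abs_sum_le_sum_abs _ _).trans (Finset.sum_le_sum fun i hi => ?_)
  rw [abs_mul, abs_pow, abs_of_nonneg (by linarith : 0 ≤ x), coeff_map]
  refine mul_le_mul_of_nonneg_left ?_ (abs_nonneg _)
  exact pow_le_pow_right₀ hx (by have := Finset.mem_range.1 hi; omega)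

theorem spec_lower {c : ℚ[X]} (hc : c ≠ 0) : ∃ K : ℝ, 0 < K ∧ ∀ᶠ x : ℝ in atTop, K ≤ |spec ℝ x c| := by
  have hc' : c.map (algebraMap ℚ ℝ) ≠ 0 := (Polynomial.map_ne_zero_iff (algebraMap ℚ ℝ).injective).2 hc
  have := isBigO_atTop_of_degree_le (1 : ℝ[X]) (c.map (algebraMap ℚ ℝ)) (by
    rw [degree_one]; exact zero_le_degree_iff.2 hc')
  obtain ⟨K, hK, h⟩ := this.exists_pos
  refine ⟨K⁻¹, inv_pos.2 hK, ?_⟩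
  filter_upwards [h.bound] with x hx
  rw [spec_real]
  rw [inv_le_iff_one_le_mul₀ hK, mul_comm]
  simpa using hx

theorem root_growth (G : ℚ[X][X]) (hG : G ≠ 0) : ∃ (K : ℝ) (N : ℕ), 0 ≤ K ∧
    ∀ᶠ x : ℝ in atTop, ∀ y, e G x y = 0 → |y| ≤ K * x ^ N := by
  obtain ⟨L, hL, hlow⟩ := spec_lower (leadingCoeff_ne_zero.2 hG)
  choose B hB0 hB using spec_bound
  let N := (Finset.range G.natDegree).sup (fun i => (G.coeff i).natDegree)
  let S := ∑ i ∈ Finset.range G.natDegree, B (G.coeff i)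
  have hS : 0 ≤ S := Finset.sum_nonneg fun i _ => hB0 _
  refine ⟨S / L + 1, N, by positivity, ?_⟩
  filter_upwards [hlow, eventually_ge_atTop 1] with x h1 h2 y hy
  have hlc : spec ℝ x G.leadingCoeff ≠ 0 := fun h => by rw [h, abs_zero] at h1; linarith
  have hne : G.map (spec ℝ x) ≠ 0 := fun h => hlc (by
    have := congrArg (fun p => coeff p G.natDegree) h
    simpa using this)
  have := IsRoot.norm_lt_cauchyBound hne (a := y) hy
  have h3 : |y| < (cauchyBound (G.map (spec ℝ x)) : ℝ) := by
    rw [← Real.norm_eq_abs, ← coe_nnnorm]; exact_mod_cast this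
  have hxN : 0 ≤ x ^ N := by positivity
  have h4 : Finset.sup (Finset.range (G.map (spec ℝ x)).natDegree)
      (‖(G.map (spec ℝ x)).coeff ·‖₊) ≤ Real.toNNReal (S * x ^ N) := by
    refine Finset.sup_le fun i hi => ?_
    rw [natDegree_map_of_leadingCoeff_ne_zero _ hlc] at hi
    rw [← NNReal.coe_le_coe, coe_nnnorm, Real.coe_toNNReal _ (by positivity), coeff_map,
      Real.norm_eq_abs]
    refine (hB _ N (Finset.le_sup (f := fun i => (G.coeff i).natDegree) hi) x h2).trans ?_
    refine mul_le_mul_of_nonneg_right ?_ hxN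
    exact Finset.single_le_sum (f := fun i => B (G.coeff i)) (fun i _ => hB0 _) hi
  have h5 : (cauchyBound (G.map (spec ℝ x)) : ℝ) ≤ S * x ^ N / L + 1 := by
    rw [cauchyBound, NNReal.coe_add, NNReal.coe_div, NNReal.coe_one, coe_nnnorm,
      leadingCoeff_map_of_leadingCoeff_ne_zero _ hlc, Real.norm_eq_abs]
    gcongr
    rw [← NNReal.coe_le_coe, Real.coe_toNNReal _ (by positivity)] at h4
    exact h4
  have h6 : 1 ≤ x ^ N := one_le_pow₀ h2
  calc |y| ≤ S * x ^ N / L + 1 := h3.le.trans h5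
    _ ≤ S * x ^ N / L + x ^ N := by linarith
    _ = _ := by ring

/-- the differential field generated by the branch -/
def Cls (G : ℚ[X][X]) (m f : ℝ → ℝ) : Prop :=
  ∃ U V : ℚ[X][X], ¬ G ∣ V ∧ ∀ᶠ x in atTop, f x = e U x (m x) / e V x (m x)

section cls
variable {G : ℚ[X][X]} (hG : Irreducible G) (hd : 0 < G.natDegree) {m : ℝ → ℝ}
  (hm : ∀ᶠ x in atTop, e G x (m x) = 0 ∧ DifferentiableAt ℝ m x)
include hG hd hm

theorem cls_ne {V : ℚ[X][X]} (hV : ¬ G ∣ V) : ∀ᶠ x in atTop, e V x (m x) ≠ 0 := by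
  obtain ⟨a, b, c, hc, hab⟩ := bezout hG hd hV
  filter_upwards [hm, spec_ev_ne hc] with x h1 h2 h3
  have := congrArg (fun U => e U x (m x)) hab
  simp only [e_add, e_mul, h1.1, h3, e_C] at this
  exact h2 (by rw [← this]; ring)

theorem cls_deriv {f : ℝ → ℝ} (hf : Cls G m f) : ∃ f', Cls G m f' ∧
    ∀ᶠ x in atTop, HasDerivAt f (f' x) x := by
  obtain ⟨U, V, hV, h⟩ := hf
  obtain ⟨G1, hG1⟩ := hasDerivAt_e G
  obtain ⟨U1, hU1⟩ := hasDerivAt_e U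
  obtain ⟨V1, hV1⟩ := hasDerivAt_e V
  have hGd : ¬ G ∣ derivative G := fun h => by
    have hder : derivative G ≠ 0 := by
      intro h
      have := derivative_eq_zero.1 h
      omega
    have h1 := natDegree_le_of_dvd h hder
    have h2 := natDegree_derivative_lt hd.ne'
    omega
  have hprime : Prime G := hG.prime
  let U' := U1 * derivative G - derivative U * G1
  let V' := V1 * derivative G - derivative V * G1
  refine ⟨fun x => e (U' * V - U * V') x (m x) / e (V * V * derivative G) x (m x),
    ⟨_, _, ?_, Eventually.of_forall fun x => rfl⟩, ?_⟩
  · intro h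
    rcases hprime.dvd_or_dvd h with h | h
    · rcases hprime.dvd_or_dvd h with h | h <;> exact hV h
    · exact hGd h
  · obtain ⟨x0, hx0⟩ := eventually_atTop.1 (hm.and (h.and ((cls_ne hG hd hm hV).and (cls_ne hG hd hm hGd))))
    filter_upwards [eventually_gt_atTop x0] with x hx
    obtain ⟨⟨-, h2⟩, h3, h4, h5⟩ := hx0 x hx.le
    have hmd := h2.hasDerivAt
    set m' := deriv m x
    have hev : ∀ᶠ t in 𝓝 x, t > x0 := eventually_gt_nhds hx
    have e1 := hG1 m m' x hmd
    have e2 : HasDerivAt (fun t => e G t (m t)) 0 x := by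
      refine (hasDerivAt_const x (0 : ℝ)).congr_of_eventuallyEq ?_
      filter_upwards [hev] with t ht using (hx0 t (le_of_lt ht)).1.1
    have e3 := e1.unique e2
    have hm' : m' = - e G1 x (m x) / e (derivative G) x (m x) := by
      rw [eq_div_iff h5]; linarith
    have e4 := (hU1 m m' x hmd).div (hV1 m m' x hmd) h4
    have e5 := e4.congr_of_eventuallyEq (f₁ := f) (by
      filter_upwards [hev] with t ht using (hx0 t (le_of_lt ht)).2.1)
    convert! e5 using 1
    simp only [U', V', e_sub, e_mul]
    rw [hm']
    field_simp
    ring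

theorem cls_sign {f : ℝ → ℝ} (hf : Cls G m f) :
    (∀ᶠ x in atTop, 0 ≤ f x) ∨ (∀ᶠ x in atTop, f x ≤ 0) := by
  obtain ⟨f', -, hf'⟩ := cls_deriv hG hd hm hf
  obtain ⟨U, V, hV, h⟩ := hf
  by_cases hU : G ∣ U
  · left
    obtain ⟨W, rfl⟩ := hU
    filter_upwards [h, hm] with x h1 h2
    rw [h1, e_mul, h2.1]; simp
  · have hne := cls_ne hG hd hm hU
    obtain ⟨x0, hx0⟩ := eventually_atTop.1 (h.and ((cls_ne hG hd hm hU).and ((cls_ne hG hd hm hV).and hf')))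
    have hne : ∀ x ≥ x0, f x ≠ 0 := fun x hx => by
      obtain ⟨h1, h2, h3, -⟩ := hx0 x hx
      rw [h1]; exact div_ne_zero h2 h3
    have hc : ContinuousOn f (Set.Ici x0) := fun x hx =>
      (hx0 x hx).2.2.2.continuousAt.continuousWithinAt
    have hpc : IsPreconnected (f '' Set.Ici x0) := isPreconnected_Ici.image f hc
    by_contra hcon
    push Not at hcon
    obtain ⟨h1, h2⟩ := hcon
    obtain ⟨a, ha, ha'⟩ := (h1.and_eventually (eventually_ge_atTop x0)).exists
    obtain ⟨b, hb, hb'⟩ := (h2.and_eventually (eventually_ge_atTop x0)).exists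
    have h3 := hpc.ordConnected.out ⟨a, ha', rfl⟩ ⟨b, hb', rfl⟩
    obtain ⟨c, hc, hc0⟩ := h3 (⟨ha.le, hb.le⟩ : (0 : ℝ) ∈ Set.Icc (f a) (f b))
    exact hne c hc hc0

theorem cls_growth {f : ℝ → ℝ} (hf : Cls G m f) (K : ℝ) (k : ℤ)
    (hb : ∀ᶠ x in atTop, |f x| ≤ K * x ^ k) :
    ∃ f', Cls G m f' ∧ (∀ᶠ x in atTop, HasDerivAt f (f' x) x) ∧
      ∃ K', ∀ᶠ x in atTop, |f' x| ≤ K' * x ^ (k - 1) := by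
  obtain ⟨f', hcls, hf'⟩ := cls_deriv hG hd hm hf
  refine ⟨f', hcls, hf', 2 * (K * (1 + 2⁻¹ ^ k)) + K * (1 + 2 ^ k), ?_⟩
  obtain ⟨f'', hcls2, hf''⟩ := cls_deriv hG hd hm hcls
  have hmono : ∃ x0, MonotoneOn f' (Set.Ici x0) ∨ AntitoneOn f' (Set.Ici x0) := by
    rcases cls_sign hG hd hm hcls2 with h | h
    · obtain ⟨x0, hx0⟩ := eventually_atTop.1 (h.and hf'')
      refine ⟨x0, Or.inl (monotoneOn_of_deriv_nonneg (convex_Ici x0) (fun x hx =>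
        (hx0 x hx).2.continuousAt.continuousWithinAt) (fun x hx => 
        (hx0 x (interior_subset hx)).2.differentiableAt.differentiableWithinAt) fun x hx => ?_)⟩
      rw [(hx0 x (interior_subset hx)).2.deriv]
      exact (hx0 x (interior_subset hx)).1
    · obtain ⟨x0, hx0⟩ := eventually_atTop.1 (h.and hf'')
      refine ⟨x0, Or.inr (antitoneOn_of_deriv_nonpos (convex_Ici x0) (fun x hx =>
        (hx0 x hx).2.continuousAt.continuousWithinAt) (fun x hx => 
        (hx0 x (interior_subset hx)).2.differentiableAt.differentiableWithinAt) fun x hx => ?_)⟩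
      rw [(hx0 x (interior_subset hx)).2.deriv]
      exact (hx0 x (interior_subset hx)).1
  obtain ⟨x0, hx0⟩ := hmono
  obtain ⟨x1, hx1⟩ := eventually_atTop.1 (hf'.and hb)
  filter_upwards [eventually_ge_atTop (2 * x0), eventually_ge_atTop (2 * x1), eventually_ge_atTop x0,
    eventually_ge_atTop x1, eventually_gt_atTop 0] with x g1 g2 g1' g2' g3
  have slope : ∀ a b, x1 ≤ a → a < b → ∃ c ∈ Set.Ioo a b, f' c = (f b - f a) / (b - a) := by
    intro a b ha hab
    refine exists_hasDerivAt_eq_slope f f' hab (fun y hy => 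
      (hx1 y (ha.trans hy.1)).1.continuousAt.continuousWithinAt) fun y hy => (hx1 y (ha.trans hy.1.le)).1
  obtain ⟨c, ⟨hc1, hc2⟩, hc⟩ := slope (x / 2) x (by linarith) (by linarith)
  obtain ⟨c', ⟨hc1', hc2'⟩, hc'⟩ := slope x (2 * x) (by linarith) (by linarith)
  have b0 := (hx1 x g2').2
  have b1 := (hx1 (x / 2) (by linarith)).2
  have b2 := (hx1 (2 * x) (by linarith)).2
  rw [div_eq_mul_inv, mul_zpow] at b1
  rw [mul_zpow] at b2
  have hxk : 0 < x ^ k := by positivity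
  have h2k : (0 : ℝ) < 2 ^ k := by positivity
  have h2k' : (0 : ℝ) < 2⁻¹ ^ k := by positivity
  have hK : 0 ≤ K := by
    by_contra hK
    have := mul_neg_of_neg_of_pos (not_le.1 hK) hxk
    have := abs_nonneg (f x)
    linarith
  have hk1 : x ^ (k - 1) = x ^ k / x := by rw [zpow_sub_one₀ g3.ne']; rfl
  have B1 : |f' c| ≤ 2 * (K * (1 + 2⁻¹ ^ k)) * x ^ (k - 1) := by
    rw [hc, abs_div, abs_of_pos (by linarith : 0 < x - x / 2), hk1,
      div_le_iff₀ (by linarith)]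
    have := abs_sub (f x) (f (x / 2))
    rw [div_eq_mul_inv x 2] at this
    calc |f x - f (x / 2)| ≤ K * x ^ k + K * (x ^ k * 2⁻¹ ^ k) := by rw [div_eq_mul_inv x 2]; linarith
      _ = _ := by field_simp; ring
  have B2 : |f' c'| ≤ K * (1 + 2 ^ k) * x ^ (k - 1) := by
    rw [hc', abs_div, abs_of_pos (by linarith : 0 < 2 * x - x), hk1,
      div_le_iff₀ (by linarith)]
    have := abs_sub (f (2 * x)) (f x)
    calc |f (2 * x) - f x| ≤ K * x ^ k + K * (2 ^ k * x ^ k) := by linarith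
      _ = _ := by field_simp; ring
  have B : |f' x| ≤ max |f' c| |f' c'| := by
    have i1 : c ∈ Set.Ici x0 := by show x0 ≤ c; linarith
    have i2 : x ∈ Set.Ici x0 := g1'
    have i3 : c' ∈ Set.Ici x0 := by show x0 ≤ c'; linarith
    rcases hx0 with h | h
    · exact abs_le_max_abs_abs (h i1 i2 hc2.le) (h i2 i3 hc1'.le)
    · rw [max_comm]
      exact abs_le_max_abs_abs (h i2 i3 hc1'.le) (h i1 i2 hc2.le) 
  have p1 : 0 ≤ 2 * (K * (1 + 2⁻¹ ^ k)) * x ^ (k - 1) := by positivity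
  have p2 : 0 ≤ K * (1 + 2 ^ k) * x ^ (k - 1) := by positivity
  refine B.trans (max_le ?_ ?_) <;> linarith

end cls

def DD : ℕ → (ℝ → ℝ) → Prop
  | 0, f => Tendsto f atTop (𝓝 0)
  | j + 1, f => ∃ f' : ℝ → ℝ, (∀ᶠ x in atTop, HasDerivAt f (f' x) x) ∧ DD j f'

theorem DD_fwd (j : ℕ) : ∀ f, DD (j + 1) f → DD j (fwdDiff 1 f) := by
  induction j with
  | zero =>
    rintro f ⟨f', h, ht⟩
    obtain ⟨x0, hx0⟩ := eventually_atTop.1 h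
    have : ∀ x, ∃ c, x0 ≤ x → x ≤ c ∧ fwdDiff 1 f x = f' c := fun x => by
      by_cases hx : x0 ≤ x
      · obtain ⟨c, hc, hc'⟩ := exists_hasDerivAt_eq_slope f f' (lt_add_one x) (fun y hy => 
          (hx0 y (hx.trans hy.1)).continuousAt.continuousWithinAt) fun y hy => hx0 y (hx.trans hy.1.le)
        exact ⟨c, fun _ => ⟨hc.1.le, by rw [hc']; simp [fwdDiff]⟩⟩
      · exact ⟨0, fun h => absurd h hx⟩
    choose c hc using this
    have hct : Tendsto c atTop atTop := tendsto_atTop_mono' _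
      (by filter_upwards [eventually_ge_atTop x0] with x hx using (hc x hx).1) tendsto_id
    refine (ht.comp hct).congr' ?_
    filter_upwards [eventually_ge_atTop x0] with x hx using (hc x hx).2.symm
  | succ j ih =>
    rintro f ⟨f', h, ht⟩
    refine ⟨fwdDiff 1 f', ?_, ih f' ht⟩
    have h2 : ∀ᶠ x in atTop, HasDerivAt f (f' (x + 1)) (x + 1) :=
      (tendsto_atTop_add_const_right _ 1 tendsto_id).eventually h
    filter_upwards [h, h2] with x h1 h2
    exact (h2.comp_add_const x 1).sub h1

theorem DD_iter (j : ℕ) : ∀ f, DD j f → Tendsto ((fwdDiff 1)^[j] f) atTop (𝓝 0) := by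
  induction j with
  | zero => intro f h; exact h
  | succ j ih => intro f h; exact ih _ (DD_fwd j f h)

theorem DD_of_growth {G : ℚ[X][X]} (hG : Irreducible G) (hd : 0 < G.natDegree) {m : ℝ → ℝ}
    (hm : ∀ᶠ x in atTop, e G x (m x) = 0 ∧ DifferentiableAt ℝ m x) (j : ℕ) :
    ∀ (f : ℝ → ℝ) (_ : Cls G m f) (K : ℝ) (k : ℤ)
    (_ : ∀ᶠ x in atTop, |f x| ≤ K * x ^ k) (_ : k < j), DD j f := by
  induction j with
  | zero =>
    intro f hf K k hb hk
    refine squeeze_zero_norm' hb ?_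
    have := (tendsto_zpow_atTop_zero (𝕜 := ℝ) (n := k) (by simpa using hk)).const_mul K
    simpa using this
  | succ j ih =>
    intro f hf K k hb hk
    obtain ⟨f', hc, h1, K', h2⟩ := cls_growth hG hd hm hf K k hb
    exact ⟨f', h1, ih f' hc K' (k - 1) h2 (by push_cast at hk; omega)⟩

theorem poly_of_fwdDiff (a : ℕ → ℤ) (j : ℕ) (h : ∀ᶠ n in atTop, (fwdDiff 1)^[j] a n = 0) :
    ∃ q : ℚ[X], ∀ᶠ n : ℕ in atTop, (a n : ℚ) = q.eval (n : ℚ) := by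
  obtain ⟨N, hN⟩ := eventually_atTop.1 h
  let q0 : ℚ[X] := ∑ k ∈ Finset.range j, C ((((fwdDiff 1)^[k] a N : ℤ) : ℚ) / (k.factorial : ℚ)) * descPochhammer ℚ k
  refine ⟨q0.comp (X - C (N : ℚ)), ?_⟩
  filter_upwards [eventually_ge_atTop N] with n hn
  obtain ⟨t, rfl⟩ := Nat.exists_eq_add_of_le hn
  have hz : ∀ k, j ≤ k → (fwdDiff 1)^[k] a N = 0 := by
    intro k hk
    obtain ⟨l, rfl⟩ := Nat.exists_eq_add_of_le hk
    have : ∀ l, ∀ n ≥ N, (fwdDiff 1)^[j + l] a n = 0 := by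
      intro l
      induction l with
      | zero => exact hN
      | succ l ih =>
        intro n hn
        rw [← add_assoc, Function.iterate_succ_apply']
        simp only [fwdDiff]
        rw [ih _ (by omega), ih _ hn, sub_zero]
    exact this l N le_rfl
  have h1 := shift_eq_sum_fwdDiff_iter (1 : ℕ) a t N
  have h2 : a (N + t) = ∑ k ∈ Finset.range j, (t.choose k : ℤ) * (fwdDiff 1)^[k] a N := by
    rw [smul_eq_mul, mul_one] at h1
    rw [h1]
    simp only [nsmul_eq_mul]
    rcases le_total j (t + 1) with hjt | hjt
    · symm
      apply Finset.sum_subset (Finset.range_mono hjt)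
      intro k _ hk
      rw [hz k (by simpa using hk), mul_zero]
    · apply Finset.sum_subset (Finset.range_mono hjt)
      intro k _ hk
      rw [Nat.choose_eq_zero_of_lt (by simpa using hk)]; simp
  rw [h2]
  simp only [eval_comp, eval_sub, eval_X, eval_C, q0, eval_finsetSum, eval_mul, Nat.cast_add, add_sub_cancel_left,
    descPochhammer_eval_eq_descFactorial, Int.cast_sum]
  refine Finset.sum_congr rfl fun k _ => ?_
  rw [Nat.descFactorial_eq_factorial_mul_choose]
  have : (k.factorial : ℚ) ≠ 0 := by positivity
  push_cast
  field_simp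
end PB3

section PB4
open Polynomial Filter Topology

theorem int_branch (G : ℚ[X][X]) (hG : Irreducible G) (hd : 0 < G.natDegree)
    (hs : ∀ᶠ n : ℕ in atTop, (G.map (spec ℝ (n : ℝ))).Splits ∧
      ∀ y : ℝ, e G (n : ℝ) y = 0 → ∃ a : ℤ, y = a) :
    ∃ q : ℚ[X], ∀ᶠ n : ℕ in atTop, (∃ a : ℤ, q.eval (n : ℚ) = a) ∧
      e G (n : ℝ) ((q.eval (n : ℚ) : ℚ) : ℝ) = 0 := by
  obtain ⟨m, hm⟩ := branch G hG hd (hs.mono fun n h => h.1).frequently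
  obtain ⟨K, N, hK, hgr⟩ := root_growth G hG.ne_zero
  have hcls : Cls G m m := ⟨X, 1, fun h => hG.not_isUnit (isUnit_of_dvd_one h), 
    Eventually.of_forall fun x => by rw [e_X, e_one, div_one]⟩
  have hDD := DD_of_growth hG hd hm (N + 1) m hcls K N (by
    filter_upwards [hgr, hm] with x h1 h2
    simpa using h1 (m x) h2.1) (by push_cast; omega)
  have ht := (DD_iter _ m hDD).comp tendsto_natCast_atTop_atTop (α := ℕ)
  have hmn : ∀ᶠ n : ℕ in atTop, e G (n : ℝ) (m n) = 0 :=
    tendsto_natCast_atTop_atTop.eventually (hm.mono fun x h => h.1)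
  let a : ℕ → ℤ := fun n => round (m n)
  have ha : ∀ᶠ n : ℕ in atTop, m n = a n := by
    filter_upwards [hmn, hs] with n h1 h2
    obtain ⟨b, hb⟩ := h2.2 _ h1
    simp [a, hb]
  obtain ⟨n0, hn0⟩ := eventually_atTop.1 ha
  have hev : ∀ᶠ n : ℕ in atTop, (fwdDiff 1)^[N + 1] a n = 0 := by
    have h1 : ∀ᶠ n : ℕ in atTop, |(fwdDiff 1)^[N + 1] m (n : ℝ)| < 1 := by
      have := ht.eventually (Metric.ball_mem_nhds (0 : ℝ) one_pos)
      filter_upwards [this] with n hn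
      simpa using hn
    filter_upwards [h1, eventually_ge_atTop n0] with n h1 h2
    have h3 : (((fwdDiff 1)^[N + 1] a n : ℤ) : ℝ) = (fwdDiff 1)^[N + 1] m (n : ℝ) := by
      rw [fwdDiff_iter_eq_sum_shift, fwdDiff_iter_eq_sum_shift]
      rw [Int.cast_sum]
      refine Finset.sum_congr rfl fun k _ => ?_
      have := hn0 (n + k) (by omega)
      push_cast at this
      simp [this]
    rw [← h3] at h1
    rw [← Int.abs_lt_one_iff]
    exact_mod_cast h1
  obtain ⟨q, hq⟩ := poly_of_fwdDiff a (N + 1) hev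
  refine ⟨q, ?_⟩
  filter_upwards [hq, ha, hmn] with n h1 h2 h3
  refine ⟨⟨a n, h1.symm⟩, ?_⟩
  rw [← h1]
  rw [h2] at h3
  simpa using h3

theorem exists_irr_factor (P : ℚ[X][X]) (hP : 0 < P.natDegree) :
    ∃ G, Irreducible G ∧ G ∣ P ∧ 0 < G.natDegree := by
  revert hP
  refine WfDvdMonoid.induction_on_irreducible P ?_ ?_ ?_
  · simp
  · intro u hu h
    rw [natDegree_eq_zero_of_isUnit hu] at h
    omega
  · intro a i ha hi ih h
    rw [natDegree_mul hi.ne_zero ha] at h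
    by_cases h2 : 0 < i.natDegree
    · exact ⟨i, hi, dvd_mul_right _ _, h2⟩
    · obtain ⟨G, h3, h4, h5⟩ := ih (by omega)
      exact ⟨G, h3, h4.mul_left _, h5⟩

theorem map_spec (G : ℚ[X][X]) (n : ℕ) : G.map (spec ℝ (n : ℝ)) =
    (G.map (evalRingHom (n : ℚ))).map (algebraMap ℚ ℝ) := by
  rw [Polynomial.map_map]
  congr 1
  apply RingHom.ext
  intro c
  rw [spec_nat]; simp

theorem claimB (s : ℕ) : ∀ (g : ℕ → ℚ[X]) (m : ℕ → Multiset ℤ)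
    (_ : ∀ k, EvRat (fun n => (g n).coeff k))
    (_ : ∀ᶠ n in atTop, (m n).card = s ∧ g n = ((m n).map fun a : ℤ => X - C (a : ℚ)).prod),
    ∃ q : Fin s → ℚ[X], ∀ᶠ n : ℕ in atTop, g n = ∏ i, (X - C ((q i).eval (n : ℚ))) := by
  induction s with
  | zero =>
    intro g m _ h
    refine ⟨fun _ => 0, ?_⟩
    filter_upwards [h] with n hn
    rw [hn.2, Multiset.card_eq_zero.1 hn.1]; simp
  | succ s ih =>
    intro g m hg h
    have hmonic : ∀ᶠ n in atTop, (g n).Monic ∧ (g n).natDegree = s + 1 := by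
      filter_upwards [h] with n hn
      rw [hn.2]
      refine ⟨monic_multiset_prod_of_monic _ _ fun a _ => monic_X_sub_C _, ?_⟩
      rw [natDegree_multiset_prod_of_monic]
      · rw [Multiset.map_map]
        simp only [Function.comp_def, natDegree_X_sub_C]
        simp [hn.1, add_comm]
      · intro f hf
        obtain ⟨a, -, rfl⟩ := Multiset.mem_map.1 hf
        exact monic_X_sub_C _
    obtain ⟨P, c, hP, hc, hPg⟩ := clear_denoms (s + 1) g (hmonic.mono fun n h => h.2.le)
      (hmonic.mono fun n h => h.1.ne_zero) hg
    have hPd : 0 < P.natDegree := by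
      obtain ⟨n, h1, h2, h3⟩ := (hPg.and (hmonic.and (ev_ne hc))).exists
      have h4 := congrArg natDegree h1
      rw [natDegree_C_mul h3, h2.2] at h4
      have := natDegree_map_le (f := evalRingHom (n : ℚ)) (p := P)
      omega
    obtain ⟨G, hG, ⟨W, hW⟩, hGd⟩ := exists_irr_factor P hPd
    have hroot : ∀ᶠ n : ℕ in atTop, ∀ y : ℝ, e G (n : ℝ) y = 0 → ∃ a ∈ m n, y = (a : ℝ) := by
      filter_upwards [h, hPg, ev_ne hc] with n h1 h2 h3 y hy
      have h4 : e P (n : ℝ) y = 0 := by rw [hW, e_mul, hy, zero_mul]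
      rw [e, map_spec, h2, h1.2] at h4
      simp only [Polynomial.map_mul, Polynomial.map_multiset_prod, eval_mul, eval_multiset_prod,
        Multiset.map_map, mul_eq_zero, Multiset.prod_eq_zero_iff] at h4
      rcases h4 with h4 | h4
      · simp at h4; exact absurd h4 h3
      · obtain ⟨a, ha, ha'⟩ := Multiset.mem_map.1 h4
        refine ⟨a, ha, ?_⟩
        simp at ha'
        linarith
    have hsp : ∀ᶠ n : ℕ in atTop, (G.map (spec ℝ (n : ℝ))).Splits := by
      filter_upwards [h, hPg, ev_ne hc, hmonic] with n h1 h2 h3 h4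
      rw [map_spec]
      refine Splits.map (Splits.of_dvd (g := C (c.eval (n : ℚ)) * g n) ?_ ?_ ?_) _
      · refine Splits.mul (Splits.C _) ?_
        rw [h1.2]
        refine Splits.multisetProd fun f hf => ?_
        obtain ⟨a, -, rfl⟩ := Multiset.mem_map.1 hf
        exact Splits.X_sub_C _
      · exact mul_ne_zero (C_ne_zero.2 h3) h4.1.ne_zero
      · rw [← h2, hW, Polynomial.map_mul]; exact dvd_mul_right _ _
    obtain ⟨q, hq⟩ := int_branch G hG hGd (by
      filter_upwards [hroot, hsp] with n h1 h2
      exact ⟨h2, fun y hy => let ⟨a, _, h⟩ := h1 y hy; ⟨a, h⟩⟩)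
    have hfac : ∀ᶠ n : ℕ in atTop, (⌊q.eval (n : ℚ)⌋ ∈ m n ∧ ((⌊q.eval (n : ℚ)⌋ : ℤ) : ℚ) = q.eval (n : ℚ)) := by
      filter_upwards [hroot, hq] with n h1 h2
      obtain ⟨a, ha, ha'⟩ := h1 _ h2.2
      have : q.eval (n : ℚ) = (a : ℚ) := by exact_mod_cast ha'
      rw [this]
      simpa using ha
    obtain ⟨q', hq'⟩ := ih (fun n => g n /ₘ (X - C (q.eval (n : ℚ))))
      (fun n => (m n).erase ⌊q.eval (n : ℚ)⌋) (by
        intro k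
        refine EvRat.congr (a := fun n => ∑ i ∈ Finset.Icc (k + 1) (s + 1),
          ((q ^ (i - (k + 1))).eval (n : ℚ)) * (g n).coeff i) ?_ ?_
        · exact EvRat.sum _ fun i _ => (EvRat.poly _).mul (hg i)
        · filter_upwards [hmonic] with n hn
          rw [coeff_divByMonic_X_sub_C, hn.2]
          simp) (by
        filter_upwards [h, hfac] with n h1 h2
        refine ⟨by rw [Multiset.card_erase_of_mem h2.1, h1.1]; rfl, ?_⟩
        rw [h1.2]
        conv_lhs => rw [← Multiset.cons_erase h2.1, Multiset.map_cons, Multiset.prod_cons, h2.2]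
        rw [mul_divByMonic_cancel_left _ (monic_X_sub_C _)])
    refine ⟨Fin.cons q q', ?_⟩
    filter_upwards [hq', h, hfac] with n h1 h2 h3
    rw [Fin.prod_univ_succ]
    simp only [Fin.cons_zero, Fin.cons_succ]
    rw [← h1, eq_comm, mul_divByMonic_eq_iff_isRoot, h2.2]
    simp only [IsRoot.def, eval_multiset_prod, Multiset.map_map, Multiset.prod_eq_zero_iff]
    refine Multiset.mem_map.2 ⟨_, h3.1, ?_⟩
    simp [h3.2]
end PB4

section PC1
open Polynomial Filter Topology

theorem perm_extend {α : Type*} [Fintype α] {n : ℕ} (f g : α ↪ Fin n) :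
    ∃ σ : Equiv.Perm (Fin n), ∀ a, σ (f a) = g a := by
  have h := Equiv.Perm.isMultiplyPretransitive (Fin n) (Fintype.card α)
  let ε := (Fintype.equivFin α).symm.toEmbedding
  obtain ⟨σ, hσ⟩ := h.exists_smul_eq (ε.trans f) (ε.trans g)
  refine ⟨σ, fun a => ?_⟩
  have := DFunLike.congr_fun hσ (Fintype.equivFin α a)
  simpa [ε] using this

/-- type of an embedding with respect to the first `d` elements -/
def ty {d n : ℕ} (f : Fin d ↪ Fin n) : Fin d → Option (Fin d) :=
  fun i => if h : (f i : ℕ) < d then some ⟨f i, h⟩ else none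

theorem ty_some {d n : ℕ} (h : d ≤ n) (f : Fin d ↪ Fin n) (i j : Fin d) :
    ty f i = some j ↔ f i = Fin.castLE h j := by
  unfold ty
  split_ifs with hh
  · simp [Fin.ext_iff]
  · simp only [false_iff]
    intro h2
    exact hh (by rw [h2]; simp)

theorem ty_none {d n : ℕ} (f : Fin d ↪ Fin n) (i : Fin d) :
    ty f i = none ↔ d ≤ (f i : ℕ) := by
  unfold ty
  split_ifs with hh
  · simp; omega
  · simpa using hh

theorem ty_castLE {d n n' : ℕ} (h : n ≤ n') (f : Fin d ↪ Fin n) :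
    ty (f.trans (Fin.castLEEmb h)) = ty f := by
  funext i; simp [ty]

theorem ty_perm {d n : ℕ} (h : d ≤ n) (f g : Fin d ↪ Fin n) (hfg : ty f = ty g) :
    ∃ σ : Equiv.Perm (Fin n), (∀ j, σ (Fin.castLE h j) = Fin.castLE h j) ∧
      f.trans σ.toEmbedding = g := by
  let mk : ∀ k : Fin d ↪ Fin n, ty k = ty f → ({i : Fin d // ty f i = none} ⊕ Fin d) ↪ Fin n := fun k hk =>
    ⟨Sum.elim (fun i => k i.1) (fun j => Fin.castLE h j), by
      apply Function.Injective.sumElim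
      · exact fun a b hab => Subtype.ext (k.injective hab)
      · exact fun a b hab => by simpa [Fin.ext_iff] using hab
      · intro a b hab
        have := (ty_none k a.1).1 (by rw [hk]; exact a.2)
        rw [hab] at this
        simp at this
        omega⟩
  obtain ⟨σ, hσ⟩ := perm_extend (mk f rfl) (mk g hfg.symm)
  refine ⟨σ, fun j => hσ (Sum.inr j), ?_⟩
  ext1 i
  rcases hi : ty f i with _ | j
  · exact hσ (Sum.inl ⟨i, hi⟩)
  · have h1 := (ty_some h f i j).1 hi
    have h2 := (ty_some h g i j).1 (by rw [← hfg, hi])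
    rw [h2]
    simp only [Function.Embedding.trans_apply, h1]
    exact hσ (Sum.inr j)

theorem evRat_descFactorial (d k : ℕ) : EvRat (fun n => (((n - d).descFactorial k : ℕ) : ℚ)) := by
  refine (EvRat.poly ((descPochhammer ℚ k).comp (X - C (d : ℚ)))).congr ?_
  filter_upwards [eventually_ge_atTop d] with n hn
  rw [eval_comp]
  simp only [eval_sub, eval_X, eval_C]
  rw [← Nat.cast_sub hn, descPochhammer_eval_eq_descFactorial]

theorem card_ty {d : ℕ} (β : Fin d → Option (Fin d)) (hβ : ∀ i j k, β i = some k → β j = some k → i = j)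
    (n : ℕ) (h : d ≤ n) :
    Nat.card {f : Fin d ↪ Fin n // ty f = β} = (n - d).descFactorial (Nat.card {i // β i = none}) := by
  classical
  have e1 : Nat.card {j : Fin n // d ≤ (j : ℕ)} = n - d := by
    rw [Nat.card_congr (β := Fin (n - d)) ?_, Nat.card_fin]
    exact {
      toFun := fun j => ⟨j.1 - d, by have := j.1.2; have := j.2; omega⟩
      invFun := fun k => ⟨⟨k + d, by have := k.2; omega⟩, by simp⟩
      left_inv := fun j => by have := j.2; ext; simp; omega
      right_inv := fun k => by ext; simp }
  rw [← e1, Nat.card_eq_fintype_card, Nat.card_eq_fintype_card, Nat.card_eq_fintype_card,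
    ← Fintype.card_embedding_eq]
  refine Fintype.card_congr ?_
  refine Equiv.ofBijective (fun f => ⟨fun i => ⟨f.1 i.1, (ty_none f.1 i.1).1 (by rw [f.2]; exact i.2)⟩, 
    fun a b hab => Subtype.ext (f.1.injective (by simpa using hab))⟩) ⟨?_, ?_⟩
  · intro f g hfg
    apply Subtype.ext
    ext1 i
    rcases hi : β i with _ | j
    · have := DFunLike.congr_fun hfg ⟨i, hi⟩
      exact congrArg Subtype.val this
    · rw [(ty_some h f.1 i j).1 (by rw [f.2, hi]), (ty_some h g.1 i j).1 (by rw [g.2, hi])]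
  · intro g
    let F : Fin d → Fin n := fun i => if hi : β i = none then (g ⟨i, hi⟩).1 else
      Fin.castLE h ((β i).get (Option.isSome_iff_ne_none.2 hi))
    have F1 : ∀ i (hi : β i = none), F i = (g ⟨i, hi⟩).1 := fun i hi => by simp only [F]; rw [dif_pos hi]
    have F2 : ∀ i j, β i = some j → F i = Fin.castLE h j := fun i j hi => by
      simp only [F]; rw [dif_neg (by simp [hi])]; simp [hi]
    have Finj : Function.Injective F := by
      intro a b hab
      rcases ha : β a with _ | j <;> rcases hb : β b with _ | k
      · rw [F1 a ha, F1 b hb] at hab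
        simpa using g.injective (Subtype.ext hab)
      · rw [F1 a ha, F2 b k hb] at hab
        have := (g ⟨a, ha⟩).2
        rw [hab] at this
        simp at this; omega
      · rw [F2 a j ha, F1 b hb] at hab
        have := (g ⟨b, hb⟩).2
        rw [← hab] at this
        simp at this; omega
      · rw [F2 a j ha, F2 b k hb] at hab
        have : j = k := by simpa [Fin.ext_iff] using hab
        subst this
        exact hβ a b j ha hb
    refine ⟨⟨⟨F, Finj⟩, ?_⟩, ?_⟩
    · funext i
      rcases hi : β i with _ | j
      · rw [ty_none]
        show d ≤ (F i : ℕ)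
        rw [F1 i hi]; exact (g ⟨i, hi⟩).2
      · rw [ty_some h]
        exact F2 i j hi
    · ext i
      show ((F i.1 : Fin n) : ℕ) = _
      rw [F1 i.1 i.2]

theorem evRat_card_emb {d : ℕ} (Φ : ∀ n, (Fin d ↪ Fin n) → Prop)
    (h1 : ∀ {n n'} (_ : d ≤ n) (h : n ≤ n') f, Φ n f → Φ n' (f.trans (Fin.castLEEmb h)))
    (h2 : ∀ {n} (h : d ≤ n) f (σ : Equiv.Perm (Fin n)), (∀ j, σ (Fin.castLE h j) = Fin.castLE h j) →
      Φ n f → Φ n (f.trans σ.toEmbedding)) :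
    EvRat (fun n => (Nat.card {f // Φ n f} : ℚ)) := by
  classical
  have hsum : ∀ n, Nat.card {f // Φ n f} = ∑ β : Fin d → Option (Fin d),
      Nat.card {f : Fin d ↪ Fin n // Φ n f ∧ ty f = β} := by
    intro n
    simp only [Nat.card_eq_fintype_card, Fintype.card_subtype]
    rw [Finset.card_eq_sum_card_fiberwise (f := ty) (t := Finset.univ) (by simp)]
    refine Finset.sum_congr rfl fun β _ => ?_
    rw [Finset.filter_filter]
  refine EvRat.congr (a := fun n => ∑ β : Fin d → Option (Fin d),
      (Nat.card {f : Fin d ↪ Fin n // Φ n f ∧ ty f = β} : ℚ)) ?_ (Eventually.of_forall fun n => by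
        rw [hsum]; push_cast; rfl)
  refine EvRat.sum _ fun β _ => ?_
  by_cases hex : ∃ n, d ≤ n ∧ ∃ f : Fin d ↪ Fin n, Φ n f ∧ ty f = β
  · obtain ⟨n0, hn0, f0, hf0, rfl⟩ := hex
    refine (evRat_descFactorial d (Nat.card {i // ty f0 i = none})).congr ?_
    filter_upwards [eventually_ge_atTop n0] with n hn
    rw [← card_ty (ty f0) ?_ n (hn0.trans hn)]
    · congr 1
      refine Nat.card_congr (Equiv.subtypeEquivRight fun f => ⟨fun h => h.2, fun h => ⟨?_, h⟩⟩)
      obtain ⟨σ, hσ, hσ2⟩ := ty_perm (hn0.trans hn) (f0.trans (Fin.castLEEmb hn)) f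
        (by rw [ty_castLE, h])
      rw [← hσ2]
      exact h2 _ _ σ hσ (h1 hn0 hn f0 hf0)
    · intro i j k hi hj
      rw [ty_some hn0] at hi hj
      exact f0.injective (hi.trans hj.symm)
  · refine (EvRat.const 0).congr ?_
    filter_upwards [eventually_ge_atTop d] with n hn
    have : IsEmpty {f : Fin d ↪ Fin n // Φ n f ∧ ty f = β} :=
      ⟨fun f => hex ⟨n, hn, f.1, f.2⟩⟩
    simp
end PC1

section PC2
open Polynomial Filter Topology

namespace FISet
variable {X : FISet}

theorem FGDeg.exists_rep {d : ℕ} (hX : X.FGDeg d) {n : ℕ} (hn : d ≤ n) (x : X.obj n) :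
    ∃ (f : Fin d ↪ Fin n) (y : X.obj d), X.map f y = x := by
  obtain ⟨m, hm, f, y, rfl⟩ := hX n x
  obtain ⟨σ, hσ⟩ := perm_extend ((Fin.castLEEmb hm).trans (Fin.castLEEmb hn)) f
  refine ⟨(Fin.castLEEmb hn).trans σ.toEmbedding, X.map (Fin.castLEEmb hm) y, ?_⟩
  rw [← X.map_comp]
  congr 1
  ext1 i
  exact hσ i

theorem exists_perm_map {d n : ℕ} (f g : Fin d ↪ Fin n) :
    ∃ σ : Equiv.Perm (Fin n), ∀ y : X.obj d, X.map g y = X.map σ.toEmbedding (X.map f y) := by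
  obtain ⟨σ, hσ⟩ := perm_extend f g
  refine ⟨σ, fun y => ?_⟩
  rw [← X.map_comp]
  congr 1
  ext1 i
  exact (hσ i).symm

theorem map_symm_map {n : ℕ} (σ : Equiv.Perm (Fin n)) (x : X.obj n) :
    X.map σ.symm.toEmbedding (X.map σ.toEmbedding x) = x := by
  rw [← X.map_comp]
  have : σ.toEmbedding.trans σ.symm.toEmbedding = Function.Embedding.refl _ := by ext1 i; simp
  rw [this, X.map_id]

theorem map_map_symm {n : ℕ} (σ : Equiv.Perm (Fin n)) (x : X.obj n) :
    X.map σ.toEmbedding (X.map σ.symm.toEmbedding x) = x := by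
  simpa using map_symm_map σ.symm x

/-- number of representations -/
noncomputable def reps (X : FISet) (d n : ℕ) (x : X.obj n) : ℕ :=
  Nat.card {z : X.obj d × (Fin d ↪ Fin n) // X.map z.2 z.1 = x}

theorem reps_perm (d : ℕ) {n : ℕ} (σ : Equiv.Perm (Fin n)) (x : X.obj n) :
    reps X d n (X.map σ.toEmbedding x) = reps X d n x := by
  refine Nat.card_congr ((Equiv.prodCongr (Equiv.refl _) 
    (Equiv.embeddingCongr (Equiv.refl _) σ.symm)).subtypeEquiv fun z => ?_)
  obtain ⟨y, f⟩ := z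
  have h1 : (Equiv.embeddingCongr (Equiv.refl _) σ.symm) f = f.trans σ.symm.toEmbedding := by
    ext1 i; rfl
  simp only [Equiv.prodCongr_apply, Prod.map, h1, Equiv.refl_apply, X.map_comp]
  constructor
  · intro h; rw [h, map_symm_map]
  · intro h; rw [← h, map_map_symm]

theorem reps_evRat (d : ℕ) (y : X.obj d) : EvRat (fun n => if h : d ≤ n then
    (reps X d n (X.map (Fin.castLEEmb h) y) : ℚ) else 0) := by
  classical
  refine EvRat.congr (a := fun n => ∑ y' : X.obj d, (Nat.card {f : Fin d ↪ Fin n // 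
    ∀ h : d ≤ n, X.map f y' = X.map (Fin.castLEEmb h) y} : ℚ)) ?_ ?_
  · refine EvRat.sum _ fun y' _ => evRat_card_emb (fun n f => ∀ h : d ≤ n, X.map f y' = X.map (Fin.castLEEmb h) y) ?_ ?_
    · intro n n' hn hnn f hf hn'
      rw [X.map_comp, hf hn, ← X.map_comp]
      rfl
    · intro n h f σ hσ hf _
      rw [X.map_comp, hf h, ← X.map_comp]
      congr 1
      ext1 i
      exact hσ i
  · filter_upwards [eventually_ge_atTop d] with n hn
    rw [dif_pos hn, reps]
    rw [← Nat.cast_sum]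
    congr 1
    simp only [Nat.card_eq_fintype_card]
    rw [← Fintype.card_sigma]
    refine Fintype.card_congr ?_
    exact {
      toFun := fun z => ⟨z.1.1, z.1.2, fun _ => z.2⟩
      invFun := fun z => ⟨(z.1, z.2.1), z.2.2 hn⟩
      left_inv := fun z => rfl
      right_inv := fun z => rfl }

theorem IsFISubset.perm_iff {Y : ∀ n, Set (X.obj n)} (hY : X.IsFISubset Y) {n : ℕ} 
    (σ : Equiv.Perm (Fin n)) (x : X.obj n) : X.map σ.toEmbedding x ∈ Y n ↔ x ∈ Y n := by
  constructor
  · intro h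
    have := hY σ.symm.toEmbedding _ h
    rwa [map_symm_map] at this
  · exact hY _ _

theorem card_evRat {d : ℕ} (hX : X.FGDeg d) {Y : ∀ n, Set (X.obj n)} (hY : X.IsFISubset Y) :
    EvRat (fun n => (Nat.card (Y n) : ℚ)) := by
  classical
  refine EvRat.congr (a := fun n => ∑ y : X.obj d,
    (if h : ∃ h : d ≤ n, X.map (Fin.castLEEmb h) y ∈ Y n then (1 : ℚ) else 0) *
      (((n - 0).descFactorial d : ℕ) : ℚ) * (if h : d ≤ n then
    (reps X d n (X.map (Fin.castLEEmb h) y) : ℚ) else 0)⁻¹) ?_ ?_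
  · refine EvRat.sum _ fun y _ => EvRat.mul (EvRat.mul ?_ (evRat_descFactorial 0 d)) (reps_evRat d y).inv
    by_cases hex : ∃ n, ∃ h : d ≤ n, X.map (Fin.castLEEmb h) y ∈ Y n
    · obtain ⟨n0, h0, hm⟩ := hex
      refine (EvRat.const 1).congr ?_
      filter_upwards [eventually_ge_atTop n0] with n hn
      rw [dif_pos]
      refine ⟨h0.trans hn, ?_⟩
      have := hY (Fin.castLEEmb hn) _ hm
      rw [← X.map_comp] at this
      exact this
    · refine (EvRat.const 0).congr (Eventually.of_forall fun n => ?_)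
      rw [dif_neg]
      exact fun h => hex ⟨n, h⟩
  · filter_upwards [eventually_ge_atTop d] with n hn
    have hpos : ∀ x : X.obj n, (reps X d n x : ℚ) ≠ 0 := by
      intro x
      obtain ⟨f, y, h⟩ := hX.exists_rep hn x
      have : Nonempty {z : X.obj d × (Fin d ↪ Fin n) // X.map z.2 z.1 = x} := ⟨⟨(y, f), h⟩⟩
      exact_mod_cast (Nat.card_pos (α := {z : X.obj d × (Fin d ↪ Fin n) // X.map z.2 z.1 = x})).ne'
    have h1 : (Nat.card (Y n) : ℚ) = ∑ x : X.obj n, if x ∈ Y n then 1 else 0 := by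
      rw [Nat.card_eq_fintype_card, ← Set.toFinset_card]
      simp
    have h2 : ∀ x : X.obj n, (if x ∈ Y n then (1 : ℚ) else 0) = 
        ∑ z : X.obj d × (Fin d ↪ Fin n), if X.map z.2 z.1 = x then
          (if X.map z.2 z.1 ∈ Y n then (1 : ℚ) else 0) * (reps X d n (X.map z.2 z.1) : ℚ)⁻¹ else 0 := by
      intro x
      have : ∀ z : X.obj d × (Fin d ↪ Fin n), (if X.map z.2 z.1 = x then
          (if X.map z.2 z.1 ∈ Y n then (1 : ℚ) else 0) * (reps X d n (X.map z.2 z.1) : ℚ)⁻¹ else 0)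
          = if X.map z.2 z.1 = x then (if x ∈ Y n then (1 : ℚ) else 0) * (reps X d n x : ℚ)⁻¹ else 0 := by
        intro z
        split_ifs <;> simp_all
      rw [Finset.sum_congr rfl fun z _ => this z, ← Finset.sum_filter, Finset.sum_const, nsmul_eq_mul,
        ← Fintype.card_subtype, ← Nat.card_eq_fintype_card]
      change _ = (reps X d n x : ℚ) * _
      have := hpos x
      field_simp
    rw [h1, Finset.sum_congr rfl fun x _ => h2 x, Finset.sum_comm, Fintype.sum_prod_type]
    simp only [Finset.sum_ite_eq, Finset.mem_univ, if_true]
    refine Finset.sum_congr rfl fun y _ => ?_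
    have h3 : ∀ f : Fin d ↪ Fin n, 
        (if X.map f y ∈ Y n then (1 : ℚ) else 0) * (reps X d n (X.map f y) : ℚ)⁻¹ =
        (if X.map (Fin.castLEEmb hn) y ∈ Y n then (1 : ℚ) else 0) * 
          (reps X d n (X.map (Fin.castLEEmb hn) y) : ℚ)⁻¹ := by
      intro f
      obtain ⟨σ, hσ⟩ := exists_perm_map (X := X) (Fin.castLEEmb hn) f
      rw [hσ, reps_perm, hY.perm_iff]
    rw [Finset.sum_congr rfl fun f _ => h3 f, Finset.sum_const, nsmul_eq_mul, Finset.card_univ,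
      Fintype.card_embedding_eq, dif_pos hn]
    have h4 : (∃ h : d ≤ n, X.map (Fin.castLEEmb h) y ∈ Y n) ↔ X.map (Fin.castLEEmb hn) y ∈ Y n :=
      ⟨fun ⟨_, h⟩ => h, fun h => ⟨hn, h⟩⟩
    simp only [Fintype.card_fin, Nat.sub_zero, dite_eq_ite]
    rw [if_congr h4 rfl rfl]
    ring

end FISet
end PC2

section PD1
open Polynomial Filter Topology

namespace FISet

/-- cartesian power -/
def pow (X : FISet) (k : ℕ) : FISet where
  obj n := Fin k → X.obj n
  map f w := fun i => X.map f (w i)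
  map_id n w := by funext i; exact X.map_id n _
  map_comp f g w := by funext i; exact X.map_comp f g _
  finite n := by infer_instance

theorem pow_fg {X : FISet} {d : ℕ} (hX : X.FGDeg d) (k : ℕ) : (X.pow k).FGDeg (k * d) := by
  classical
  intro n w
  choose m hm f y hy using fun i : Fin k => hX n (w i)
  let U : Finset (Fin n) := Finset.univ.biUnion fun i => Finset.univ.map (f i)
  have hU : U.card ≤ k * d := by
    refine (Finset.card_biUnion_le).trans ?_
    calc ∑ i : Fin k, (Finset.univ.map (f i)).card ≤ ∑ i : Fin k, d :=
          Finset.sum_le_sum fun i _ => by simpa using hm i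
      _ = k * d := by simp
  let g : Fin U.card ↪ Fin n := U.equivFin.symm.toEmbedding.trans (Function.Embedding.subtype _)
  have hmem : ∀ i a, f i a ∈ U := fun i a => 
    Finset.mem_biUnion.2 ⟨i, Finset.mem_univ _, Finset.mem_map_of_mem _ (Finset.mem_univ _)⟩
  let h : ∀ i, Fin (m i) ↪ Fin U.card := fun i => 
    ⟨fun a => U.equivFin ⟨f i a, hmem i a⟩, fun a b hab => by
      have := U.equivFin.injective hab
      exact (f i).injective (by simpa using this)⟩
  refine ⟨U.card, hU, g, fun i => X.map (h i) (y i), ?_⟩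
  funext i
  show X.map g (X.map (h i) (y i)) = w i
  rw [← X.map_comp, ← hy i]
  congr 1
  ext1 a
  show ((U.equivFin.symm (U.equivFin ⟨f i a, hmem i a⟩) : U) : Fin n) = f i a
  simp

end FISet

theorem pow_eq_walks {V : Type*} [Fintype V] [DecidableEq V] (A : Matrix V V ℂ) (k : ℕ) (y x : V) :
    (A ^ k) y x = ∑ w : Fin (k + 1) → V, if w 0 = x ∧ w (Fin.last k) = y then
      ∏ i : Fin k, A (w i.succ) (w i.castSucc) else 0 := by
  induction k generalizing x with
  | zero =>
    rw [Fintype.sum_equiv (Equiv.funUnique (Fin 1) V) _ (fun v => if v = x ∧ v = y then 1 else 0)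
      (fun w => by simp)]
    rw [pow_zero, Matrix.one_apply, Finset.sum_ite, Finset.sum_const_zero, add_zero, Finset.sum_const]
    split_ifs with h
    · subst h; simp [Finset.filter_eq']
    · rw [Finset.filter_false_of_mem]; simp
      rintro v - ⟨h1, h2⟩; exact h (h2.symm.trans h1)
  | succ k ih =>
    rw [pow_succ, Matrix.mul_apply]
    simp only [ih]
    rw [← Fintype.sum_equiv (Fin.consEquiv fun _ => V) (fun z => if z.1 = x ∧ z.2 (Fin.last k) = y then
      A (z.2 0) z.1 * ∏ i : Fin k, A (z.2 i.succ) (z.2 i.castSucc) else 0) _ (fun z => ?_)]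
    · rw [Fintype.sum_prod_type]
      simp only [Finset.sum_mul]
      rw [Finset.sum_comm, Finset.sum_comm (s := Finset.univ (α := V))]
      refine Finset.sum_congr rfl fun w _ => ?_
      have h1 : ∀ z, (if w 0 = z ∧ w (Fin.last k) = y then
          ∏ i : Fin k, A (w i.succ) (w i.castSucc) else 0) * A z x = if w 0 = z then
          (if w (Fin.last k) = y then
          A (w 0) x * ∏ i : Fin k, A (w i.succ) (w i.castSucc) else 0) else 0 := by
        intro z
        by_cases h : w 0 = z
        · subst h; by_cases h2 : w (Fin.last k) = y <;> simp [h2, mul_comm]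
        · simp [h]
      have h2 : ∀ z, (if z = x ∧ w (Fin.last k) = y then
          A (w 0) z * ∏ i : Fin k, A (w i.succ) (w i.castSucc) else 0) = if z = x then
          (if w (Fin.last k) = y then
          A (w 0) x * ∏ i : Fin k, A (w i.succ) (w i.castSucc) else 0) else 0 := by
        intro z
        by_cases h : z = x
        · subst h; by_cases h2 : w (Fin.last k) = y <;> simp [h2]
        · simp [h]
      rw [Finset.sum_congr rfl fun z _ => h1 z, Finset.sum_congr rfl fun z _ => h2 z]
      simp
    · simp only [Fin.consEquiv_apply, Fin.prod_univ_succ]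
      simp [← Fin.succ_last, Fin.cons_succ, Fin.castSucc_zero]
      try rfl

/-- closed walks -/
def closedWalks (X : FISet) (R : ∀ n, Set ((X.prod X).obj n)) (k n : ℕ) : Set ((X.pow (k + 1)).obj n) :=
  {w | w 0 = w (Fin.last k) ∧ ∀ i : Fin k, (w i.castSucc, w i.succ) ∈ R n}

theorem closedWalks_sub {X : FISet} {R : ∀ n, Set ((X.prod X).obj n)} (hR : (X.prod X).IsFISubset R)
    (k : ℕ) : (X.pow (k + 1)).IsFISubset (closedWalks X R k) := by
  intro m n f w hw
  exact ⟨congrArg (X.map f) hw.1, fun i => hR f _ (hw.2 i)⟩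

theorem trace_eq_card (X : FISet) (R : ∀ n, Set ((X.prod X).obj n)) (k n : ℕ) [DecidableEq (X.obj n)] :
    (relMatC X R n ^ k).trace = ((Nat.card (closedWalks X R k n) : ℚ) : ℂ) := by
  classical
  simp only [Matrix.trace, Matrix.diag, pow_eq_walks]
  rw [Finset.sum_comm]
  have h1 : ∀ w : Fin (k + 1) → X.obj n, (∑ x, if w 0 = x ∧ w (Fin.last k) = x then
      ∏ i : Fin k, relMatC X R n (w i.succ) (w i.castSucc) else 0) = 
      if w ∈ closedWalks X R k n then 1 else 0 := by
    intro w
    have h2 : ∀ x, (if w 0 = x ∧ w (Fin.last k) = x then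
      ∏ i : Fin k, relMatC X R n (w i.succ) (w i.castSucc) else 0) = if w 0 = x then 
        (if w 0 = w (Fin.last k) then 
      ∏ i : Fin k, relMatC X R n (w i.succ) (w i.castSucc) else 0) else 0 := by
      intro x
      by_cases h : w 0 = x
      · subst h; simp [eq_comm]
      · simp [h]
    rw [Finset.sum_congr rfl fun x _ => h2 x]
    simp only [Finset.sum_ite_eq, Finset.mem_univ, if_true]
    have h3 : ∏ i : Fin k, relMatC X R n (w i.succ) (w i.castSucc) = 
        if ∀ i : Fin k, (w i.castSucc, w i.succ) ∈ R n then 1 else 0 := by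
      simp only [relMatC]
      rw [Finset.prod_ite_zero]
      simp
    rw [h3, ← ite_and]
    exact if_congr Iff.rfl rfl rfl
  have h4 : Nat.card (closedWalks X R k n) =
      (Finset.univ.filter fun w : Fin (k + 1) → X.obj n => w ∈ closedWalks X R k n).card := by
    change Nat.card {w : Fin (k + 1) → X.obj n // w ∈ closedWalks X R k n} = _
    rw [Nat.card_eq_fintype_card, Fintype.card_subtype]
  rw [Finset.sum_congr rfl fun w _ => h1 w, Finset.sum_boole, h4]
  push_cast
  rfl

theorem trace_evRat {X : FISet} {d : ℕ} (hX : X.FGDeg d) {R : ∀ n, Set ((X.prod X).obj n)}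
    (hR : (X.prod X).IsFISubset R) (k : ℕ) :
    EvRat (fun n => (Nat.card (closedWalks X R k n) : ℚ)) :=
  FISet.card_evRat (FISet.pow_fg hX (k + 1)) (closedWalks_sub hR k)
end PD1

section PD2
open Polynomial Filter Topology

theorem gen_ne_bot_iff {V : Type*} [AddCommGroup V] [Module ℂ V] [FiniteDimensional ℂ V]
    (f : Module.End ℂ V) (μ : ℂ) : f.maxGenEigenspace μ ≠ ⊥ ↔ f.HasEigenvalue μ := by
  rw [Module.End.hasEigenvalue_iff_isRoot_charpoly, ← Polynomial.rootMultiplicity_pos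
    f.charpoly_monic.ne_zero, ← LinearMap.finrank_maxGenEigenspace_eq, Nat.pos_iff_ne_zero, Ne,
    Ne, Submodule.finrank_eq_zero]

theorem trace_pow_eq {V : Type*} [AddCommGroup V] [Module ℂ V] [FiniteDimensional ℂ V]
    (f : Module.End ℂ V) : ∃ ev : Finset ℂ, (∀ μ, μ ∈ ev ↔ f.HasEigenvalue μ) ∧
      ∀ k, LinearMap.trace ℂ V (f ^ k) =
        ∑ μ ∈ ev, (Module.finrank ℂ (f.maxGenEigenspace μ) : ℂ) * μ ^ k := by
  classical
  have h_fin : {μ | f.maxGenEigenspace μ ≠ ⊥}.Finite :=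
      WellFoundedGT.finite_ne_bot_of_iSupIndep f.independent_maxGenEigenspace
  have hds := DirectSum.isInternal_submodule_of_iSupIndep_of_iSup_eq_top
      f.independent_maxGenEigenspace f.iSup_maxGenEigenspace_eq_top
  refine ⟨h_fin.toFinset, fun μ => ?_, fun k => ?_⟩
  · rw [Set.Finite.mem_toFinset]; exact gen_ne_bot_iff f μ
  · have hm : ∀ μ, Set.MapsTo (f ^ k) ↑(f.maxGenEigenspace μ) ↑(f.maxGenEigenspace μ) :=
      fun μ => f.mapsTo_maxGenEigenspace_of_comm ((Commute.refl f).pow_right k) μ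
    rw [LinearMap.trace_eq_sum_trace_restrict' hds h_fin hm]
    refine Finset.sum_congr rfl fun μ _ => ?_
    have h1 : Set.MapsTo f ↑(f.maxGenEigenspace μ) ↑(f.maxGenEigenspace μ) :=
      f.mapsTo_maxGenEigenspace_of_comm (Commute.refl f) μ
    have h2 : (f ^ k).restrict (hm μ) = (f.restrict h1) ^ k := (Module.End.pow_restrict k h1).symm
    have h3 : IsNilpotent (f.restrict h1 - algebraMap ℂ _ μ) := by
      have := f.isNilpotent_restrict_maxGenEigenspace_sub_algebraMap μ
      convert this using 1
      ext x
      simp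
      rfl
    rw [h2]
    clear h2 hm
    induction k with
    | zero => rw [pow_zero, pow_zero, LinearMap.trace_one, mul_one]
    | succ k ih =>
      rw [pow_succ, Module.End.mul_eq_comp, LinearMap.trace_comp_eq_mul_of_commute_of_isNilpotent μ
        ((Commute.refl _).pow_left k) h3, ih]
      ring

theorem relMat_perm {X : FISet} {R : ∀ n, Set ((X.prod X).obj n)} (hR : (X.prod X).IsFISubset R)
    {n : ℕ} (σ : Equiv.Perm (Fin n)) (y x : X.obj n) :
    relMatC X R n (X.map σ.toEmbedding y) (X.map σ.toEmbedding x) = relMatC X R n y x := by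
  classical
  simp only [relMatC]
  exact if_congr (FISet.IsFISubset.perm_iff hR σ (x, y)) rfl rfl

theorem relMat_pow_perm {X : FISet} {R : ∀ n, Set ((X.prod X).obj n)} (hR : (X.prod X).IsFISubset R)
    {n : ℕ} [DecidableEq (X.obj n)] (σ : Equiv.Perm (Fin n)) (k : ℕ) (y x : X.obj n) :
    (relMatC X R n ^ k) (X.map σ.toEmbedding y) (X.map σ.toEmbedding x) = (relMatC X R n ^ k) y x := by
  let e : X.obj n ≃ X.obj n := ⟨X.map σ.toEmbedding, X.map σ.symm.toEmbedding,
    fun x => X.map_symm_map σ x, fun x => X.map_map_symm σ x⟩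
  have h : (relMatC X R n).submatrix e e = relMatC X R n := by
    ext a b; exact relMat_perm hR σ a b
  have h2 : ((relMatC X R n) ^ k).submatrix e e = relMatC X R n ^ k := by
    induction k with
    | zero => rw [pow_zero, Matrix.submatrix_one_equiv]
    | succ k ih => rw [pow_succ, ← Matrix.submatrix_mul_equiv _ _ e e e, ih, h]
  exact congrFun (congrFun h2 y) x

theorem eig_bound {X : FISet} {d : ℕ} (hX : X.FGDeg d) {R : ∀ n, Set ((X.prod X).obj n)}
    (hR : (X.prod X).IsFISubset R) : ∃ N, ∀ n, 2 * d ≤ n → ∃ p : ℂ[X], p ≠ 0 ∧ p.natDegree ≤ N ∧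
      aeval (relEnd X R n) p = 0 := by
  classical
  refine ⟨Fintype.card ((X.pow 2).obj (2 * d)), fun n hn => ?_⟩
  set N := Fintype.card ((X.pow 2).obj (2 * d))
  letI : DecidableEq (X.obj n) := Classical.decEq _
  let ι : Fin (2 * d) ↪ Fin n := Fin.castLEEmb hn
  let v : Fin (N + 1) → ((X.pow 2).obj (2 * d) → ℂ) := fun k w =>
    (relMatC X R n ^ (k : ℕ)) (X.map ι (w 0)) (X.map ι (w 1))
  have hv : ¬ LinearIndependent ℂ v := by
    intro h
    have := h.fintype_card_le_finrank
    simp [N] at this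
  obtain ⟨g, hg, i, hi⟩ := Fintype.not_linearIndependent_iff.1 hv
  refine ⟨∑ k : Fin (N + 1), C (g k) * Polynomial.X ^ (k : ℕ), ?_, ?_, ?_⟩
  · intro h0
    have := congrArg (fun p => p.coeff (i : ℕ)) h0
    simp [Polynomial.finsetSum_coeff, Polynomial.coeff_C_mul, Polynomial.coeff_X_pow, Fin.val_inj] at this
    exact hi this
  · refine Polynomial.natDegree_sum_le_of_forall_le _ _ fun k _ => 
      (Polynomial.natDegree_C_mul_X_pow_le _ _).trans (by omega)
  · have h1 : ∑ k : Fin (N + 1), g k • (relMatC X R n ^ (k : ℕ)) = 0 := by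
      ext y x
      obtain ⟨f, w, hw⟩ := (FISet.pow_fg hX 2).exists_rep hn (![y, x] : (X.pow 2).obj n)
      obtain ⟨σ, hσ⟩ := X.exists_perm_map ι f
      have hy : y = X.map σ.toEmbedding (X.map ι (w 0)) := by
        rw [← hσ]; exact (congrFun hw 0).symm
      have hx : x = X.map σ.toEmbedding (X.map ι (w 1)) := by
        rw [← hσ]; exact (congrFun hw 1).symm
      rw [hy, hx]
      have := congrFun hg w
      simp only [Finset.sum_apply, Pi.smul_apply, v] at this
      simp only [Matrix.sum_apply, Matrix.smul_apply, Matrix.zero_apply, relMat_pow_perm hR]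
      exact this
    have h2 : relEnd X R n = Matrix.toLinAlgEquiv' (relMatC X R n) := rfl
    rw [h2, map_sum]
    have := congrArg (Matrix.toLinAlgEquiv' (R := ℂ) (n := X.obj n)) h1
    rw [map_sum, map_zero] at this
    rw [← this]
    refine Finset.sum_congr rfl fun k _ => ?_
    rw [map_mul, aeval_C, map_pow, aeval_X, map_smul, map_pow, Algebra.smul_def]

theorem eig_data {X : FISet} {d : ℕ} (hX : X.FGDeg d) {R : ∀ n, Set ((X.prod X).obj n)}
    (hR : (X.prod X).IsFISubset R) : ∃ (ev : ℕ → Finset ℂ) (N : ℕ),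
      (∀ n μ, μ ∈ ev n ↔ (relEnd X R n).HasEigenvalue μ) ∧ (∀ᶠ n in atTop, (ev n).card ≤ N) ∧
      ∀ n k, ((Nat.card (closedWalks X R k n) : ℚ) : ℂ) =
        ∑ μ ∈ ev n, (Module.finrank ℂ ((relEnd X R n).maxGenEigenspace μ) : ℂ) * μ ^ k := by
  classical
  choose ev h1 h2 using fun n => trace_pow_eq (relEnd X R n)
  obtain ⟨N, hN⟩ := eig_bound hX hR
  refine ⟨ev, N, h1, ?_, fun n k => ?_⟩
  · filter_upwards [eventually_ge_atTop (2 * d)] with n hn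
    obtain ⟨p, hp, hd, ha⟩ := hN n hn
    refine le_trans ?_ ((p.card_roots').trans hd)
    refine le_trans (Finset.card_le_card (t := p.roots.toFinset) fun μ hμ => ?_)
      (Multiset.toFinset_card_le _)
    obtain ⟨v, hv⟩ := ((h1 n μ).1 hμ).exists_hasEigenvector
    have := Module.End.aeval_apply_of_hasEigenvector (p := p) hv
    rw [ha] at this
    rw [Multiset.mem_toFinset, mem_roots hp, IsRoot]
    have h3 := (smul_eq_zero.1 this.symm)
    exact h3.resolve_right hv.2
  · rw [← h2, ← trace_eq_card]
    letI : DecidableEq (X.obj n) := Classical.decEq _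
    have h2 : relEnd X R n = Matrix.toLinAlgEquiv' (relMatC X R n) := rfl
    rw [h2, ← map_pow]
    exact (Matrix.trace_toLin'_eq _).symm
end PD2

section PE1
open Polynomial Filter Topology

theorem perm_of_prod_eq {ι : Type*} [Fintype ι] [DecidableEq ι] (a b : ι → ℚ)
    (h : ∏ i, (X - C (a i)) = ∏ i, (X - C (b i))) : ∃ σ : Equiv.Perm ι, ∀ i, a (σ i) = b i := by
  have h1 : (Finset.univ.val.map a) = (Finset.univ.val.map b) := by
    have h2 := congrArg Polynomial.roots h
    have h3 : ∀ c : ι → ℚ, (∏ i, (X - C (c i))).roots = Finset.univ.val.map c := by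
      intro c
      have := Polynomial.roots_multiset_prod_X_sub_C (Finset.univ.val.map c)
      rw [Multiset.map_map] at this
      exact this
    rwa [h3, h3] at h2
  have h2 : ∀ c : ℚ, Nonempty ({x // b x = c} ≃ {x // a x = c}) := by
    intro c
    rw [← Fintype.card_eq, Fintype.card_subtype, Fintype.card_subtype]
    have := congrArg (Multiset.count c) h1
    rw [Multiset.count_map, Multiset.count_map] at this
    simp only [eq_comm (a := c)] at this
    exact this.symm
  have e := fun c => (h2 c).some
  refine ⟨((Equiv.sigmaFiberEquiv b).symm.trans (Equiv.sigmaCongrRight e)).trans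
    (Equiv.sigmaFiberEquiv a), fun i => ?_⟩
  exact (e (b i) ⟨i, rfl⟩).2

/-- Hankel matrix -/
def hankel (T : ℕ → ℚ) (k c : ℕ) : Matrix (Fin k) (Fin k) ℚ := Matrix.of fun i j => T (i + j + c)

theorem hankel_map {s : ℕ} {T : ℕ → ℚ} {g m : Fin s → ℂ} (hT : ∀ k, (T k : ℂ) = ∑ a, m a * g a ^ k)
    (k c : ℕ) : (hankel T k c).map (algebraMap ℚ ℂ) =
      (Matrix.of fun (i : Fin k) (a : Fin s) => g a ^ (i : ℕ)) *
        Matrix.diagonal (fun a => m a * g a ^ c) *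
        (Matrix.of fun (a : Fin s) (i : Fin k) => g a ^ (i : ℕ)) := by
  ext i j
  rw [Matrix.mul_apply]
  simp only [Matrix.mul_diagonal, Matrix.map_apply, hankel, Matrix.of_apply, eq_ratCast, hT]
  refine Finset.sum_congr rfl fun a _ => ?_
  ring

theorem det_map_zero_iff {k : ℕ} (M : Matrix (Fin k) (Fin k) ℚ) :
    (M.map (algebraMap ℚ ℂ)).det = 0 ↔ M.det = 0 := by
  rw [← RingHom.mapMatrix_apply, ← RingHom.map_det, map_eq_zero]

theorem hankel_zero {s : ℕ} {T : ℕ → ℚ} {g m : Fin s → ℂ} (hT : ∀ k, (T k : ℂ) = ∑ a, m a * g a ^ k)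
    {k : ℕ} (hk : s < k) : (hankel T k 0).det = 0 := by
  rw [← det_map_zero_iff, hankel_map hT, ← Matrix.exists_mulVec_eq_zero_iff]
  have := LinearMap.ker_ne_bot_of_finrank_lt (K := ℂ)
    (f := Matrix.mulVecLin (Matrix.of fun (a : Fin s) (i : Fin k) => g a ^ (i : ℕ))) (by simpa)
  obtain ⟨v, hv, hv0⟩ := Submodule.exists_mem_ne_zero_of_ne_bot this
  refine ⟨v, hv0, ?_⟩
  rw [LinearMap.mem_ker, Matrix.mulVecLin_apply] at hv
  rw [← Matrix.mulVec_mulVec, hv, Matrix.mulVec_zero]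

theorem vand_det {s : ℕ} {g : Fin s → ℂ} (hg : Function.Injective g) :
    (Matrix.of fun (a : Fin s) (i : Fin s) => g a ^ (i : ℕ)).det ≠ 0 :=
  Matrix.det_vandermonde_ne_zero_iff.2 hg

theorem vand_det' {s : ℕ} {g : Fin s → ℂ} (hg : Function.Injective g) :
    (Matrix.of fun (i : Fin s) (a : Fin s) => g a ^ (i : ℕ)).det ≠ 0 := by
  rw [← Matrix.det_transpose]; exact vand_det hg

theorem hankel_ne {s : ℕ} {T : ℕ → ℚ} {g m : Fin s → ℂ} (hT : ∀ k, (T k : ℂ) = ∑ a, m a * g a ^ k)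
    (hg : Function.Injective g) (hm : ∀ a, m a ≠ 0) : (hankel T s 0).det ≠ 0 := by
  rw [Ne, ← det_map_zero_iff, hankel_map hT, Matrix.det_mul, Matrix.det_mul, Matrix.det_diagonal]
  exact mul_ne_zero (mul_ne_zero (vand_det' hg) (Finset.prod_ne_zero_iff.2 fun a _ => by
    simpa using hm a)) (vand_det hg)

theorem conj_eq {s : ℕ} (P V D : Matrix (Fin s) (Fin s) ℂ) (D' : Matrix (Fin s) (Fin s) ℂ)
    (hP : P.det ≠ 0) (hV : V.det ≠ 0) (hD : D.det ≠ 0) :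
    (P * D * V)⁻¹ * (P * (D * D') * V) = V⁻¹ * D' * V := by
  have h1 : P⁻¹ * P = 1 := Matrix.nonsing_inv_mul _ (isUnit_iff_ne_zero.2 hP)
  have h2 : D⁻¹ * D = 1 := Matrix.nonsing_inv_mul _ (isUnit_iff_ne_zero.2 hD)
  rw [Matrix.mul_inv_rev, Matrix.mul_inv_rev]
  calc V⁻¹ * (D⁻¹ * P⁻¹) * (P * (D * D') * V) = V⁻¹ * (D⁻¹ * ((P⁻¹ * P) * D)) * D' * V := by
        simp only [Matrix.mul_assoc]
    _ = _ := by rw [h1, Matrix.one_mul, h2, Matrix.mul_one]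

theorem conj_charpoly {s : ℕ} (V D : Matrix (Fin s) (Fin s) ℂ) (hV : V.det ≠ 0) :
    (V⁻¹ * D * V).charpoly = D.charpoly := by
  have h1 : IsUnit V := (Matrix.isUnit_iff_isUnit_det _).2 (isUnit_iff_ne_zero.2 hV)
  obtain ⟨u, rfl⟩ := h1
  have := Matrix.charpoly_units_conj' u D
  exact this

theorem mconj_pow {s : ℕ} (V D : Matrix (Fin s) (Fin s) ℂ) (hV : V.det ≠ 0) (k : ℕ) :
    ((V⁻¹ * D * V) ^ k).trace = (D ^ k).trace := by
  have h1 : V * V⁻¹ = 1 := Matrix.mul_nonsing_inv _ (isUnit_iff_ne_zero.2 hV)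
  have h0 : V⁻¹ * V = 1 := Matrix.nonsing_inv_mul _ (isUnit_iff_ne_zero.2 hV)
  have h2 : (V⁻¹ * D * V) ^ k = V⁻¹ * (D ^ k) * V := by
    induction k with
    | zero => simp [h0]
    | succ k ih =>
      rw [pow_succ, ih, pow_succ]
      calc V⁻¹ * D ^ k * V * (V⁻¹ * D * V) = V⁻¹ * D ^ k * (V * V⁻¹) * D * V := by
            simp only [Matrix.mul_assoc]
        _ = _ := by rw [h1, Matrix.mul_one]; simp only [Matrix.mul_assoc]
  rw [h2, Matrix.trace_mul_comm, ← Matrix.mul_assoc, h1, Matrix.one_mul]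

/-- companion -/
noncomputable def compM (T : ℕ → ℚ) (s : ℕ) : Matrix (Fin s) (Fin s) ℚ :=
  (hankel T s 0)⁻¹ * hankel T s 1

/-- multiplicity matrix -/
noncomputable def multM (T : ℕ → ℚ) (s : ℕ) : Matrix (Fin s) (Fin s) ℚ :=
  (hankel (fun k => (compM T s ^ k).trace) s 0)⁻¹ * hankel T s 0

theorem mmap_inv_mul {k : ℕ} (M N : Matrix (Fin k) (Fin k) ℚ) :
    (M⁻¹ * N).map (algebraMap ℚ ℂ) = (M.map (algebraMap ℚ ℂ))⁻¹ * N.map (algebraMap ℚ ℂ) := by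
  rw [Matrix.map_mul]
  congr 1
  rw [Matrix.inv_def, Matrix.inv_def, ← RingHom.mapMatrix_apply, ← RingHom.mapMatrix_apply,
    ← RingHom.map_adjugate, ← RingHom.map_det]
  ext i j
  simp

theorem compM_map {s : ℕ} {T : ℕ → ℚ} {g m : Fin s → ℂ} (hT : ∀ k, (T k : ℂ) = ∑ a, m a * g a ^ k)
    (hg : Function.Injective g) (hm : ∀ a, m a ≠ 0) :
    (compM T s).map (algebraMap ℚ ℂ) = (Matrix.of fun (a : Fin s) (i : Fin s) => g a ^ (i : ℕ))⁻¹ *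
      Matrix.diagonal g * (Matrix.of fun (a : Fin s) (i : Fin s) => g a ^ (i : ℕ)) := by
  rw [compM, mmap_inv_mul, hankel_map hT, hankel_map hT]
  have : Matrix.diagonal (fun a => m a * g a ^ 1) = Matrix.diagonal (fun a => m a * g a ^ 0) *
      Matrix.diagonal g := by
    rw [Matrix.diagonal_mul_diagonal]; simp
  rw [this]
  refine conj_eq _ _ _ _ (vand_det' hg) (vand_det hg) ?_
  rw [Matrix.det_diagonal]
  exact Finset.prod_ne_zero_iff.2 fun a _ => by simpa using hm a

theorem compM_charpoly {s : ℕ} {T : ℕ → ℚ} {g m : Fin s → ℂ}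
    (hT : ∀ k, (T k : ℂ) = ∑ a, m a * g a ^ k)
    (hg : Function.Injective g) (hm : ∀ a, m a ≠ 0) :
    (compM T s).charpoly.map (algebraMap ℚ ℂ) = ∏ a, (X - C (g a)) := by
  rw [← Matrix.charpoly_map, compM_map hT hg hm, conj_charpoly _ _ (vand_det hg),
    Matrix.charpoly_diagonal]

theorem compM_trace {s : ℕ} {T : ℕ → ℚ} {g m : Fin s → ℂ}
    (hT : ∀ k, (T k : ℂ) = ∑ a, m a * g a ^ k)
    (hg : Function.Injective g) (hm : ∀ a, m a ≠ 0) (k : ℕ) :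
    (((compM T s ^ k).trace : ℚ) : ℂ) = ∑ a, 1 * g a ^ k := by
  have := mconj_pow _ (Matrix.diagonal g) (vand_det hg) k
  rw [← compM_map hT hg hm, Matrix.diagonal_pow, Matrix.trace_diagonal] at this
  simp only [one_mul]
  simp only [Pi.pow_apply] at this
  rw [← this, ← RingHom.mapMatrix_apply, ← map_pow, RingHom.mapMatrix_apply]
  simp [Matrix.trace]

theorem multM_charpoly {s : ℕ} {T : ℕ → ℚ} {g : Fin s → ℂ} {m : Fin s → ℕ}
    (hT : ∀ k, (T k : ℂ) = ∑ a, (m a : ℂ) * g a ^ k)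
    (hg : Function.Injective g) (hm : ∀ a, m a ≠ 0) :
    (multM T s).charpoly = ∏ a, (X - C (m a : ℚ)) := by
  have hm' : ∀ a, (m a : ℂ) ≠ 0 := fun a => Nat.cast_ne_zero.2 (hm a)
  apply Polynomial.map_injective (algebraMap ℚ ℂ) (algebraMap ℚ ℂ).injective
  rw [← Matrix.charpoly_map, multM, mmap_inv_mul, hankel_map hT,
    hankel_map (compM_trace hT hg hm')]
  have : Matrix.diagonal (fun a => (m a : ℂ) * g a ^ 0) = Matrix.diagonal (fun a => 1 * g a ^ 0) *
      Matrix.diagonal (fun a => (m a : ℂ)) := by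
    rw [Matrix.diagonal_mul_diagonal]; simp
  rw [this, conj_eq _ _ _ _ (vand_det' hg) (vand_det hg) (by simp), conj_charpoly _ _ (vand_det hg),
    Matrix.charpoly_diagonal, Polynomial.map_prod]
  simp
end PE1

section PE2
open Polynomial Filter Topology

theorem hankel_ev {T : ℕ → ℕ → ℚ} (hT : ∀ k, EvRat (fun n => T n k)) (s c : ℕ) :
    EvMat (fun n => hankel (T n) s c) := fun i j => hT _

theorem compM_ev {T : ℕ → ℕ → ℚ} (hT : ∀ k, EvRat (fun n => T n k)) (s : ℕ) :
    EvMat (fun n => compM (T n) s) := (hankel_ev hT s 0).inv.mul (hankel_ev hT s 1)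

theorem multM_ev {T : ℕ → ℕ → ℚ} (hT : ∀ k, EvRat (fun n => T n k)) (s : ℕ) :
    EvMat (fun n => multM (T n) s) :=
  (hankel_ev (T := fun n k => (compM (T n) s ^ k).trace)
    (fun k => ((compM_ev hT s).pow k).trace) s 0).inv.mul (hankel_ev hT s 0)

theorem sum_enum {s : ℕ} (S : Finset ℂ) (e : S ≃ Fin s) (F : ℂ → ℂ) :
    ∑ z ∈ S, F z = ∑ a, F (e.symm a) := by
  rw [← Finset.sum_coe_sort]
  exact Fintype.sum_equiv e _ _ (fun x => by simp)

theorem card_const (ev : ℕ → Finset ℂ) (mu : ℕ → ℂ → ℕ) (hmu : ∀ n, ∀ z ∈ ev n, mu n z ≠ 0)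
    (N : ℕ) (hN : ∀ᶠ n in atTop, (ev n).card ≤ N) (T : ℕ → ℕ → ℚ)
    (hT : ∀ k, EvRat (fun n => T n k))
    (hTr : ∀ n k, (T n k : ℂ) = ∑ z ∈ ev n, (mu n z : ℂ) * z ^ k) :
    ∃ s, ∀ᶠ n in atTop, (ev n).card = s := by
  have hTr' : ∀ n k, (T n k : ℂ) = ∑ a, (mu n ((ev n).equivFin.symm a) : ℂ) *
      (((ev n).equivFin.symm a : ev n) : ℂ) ^ k := fun n k => by
    rw [hTr, sum_enum (ev n) (ev n).equivFin]
  have hz : ∀ n k, (ev n).card < k → (hankel (T n) k 0).det = 0 := fun n k hk =>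
    hankel_zero (hTr' n) hk
  have hn : ∀ n, (hankel (T n) (ev n).card 0).det ≠ 0 := fun n =>
    hankel_ne (hTr' n) (fun a b h => (ev n).equivFin.symm.injective (Subtype.ext h))
      (fun a => Nat.cast_ne_zero.2 (hmu n _ (Subtype.mem _)))
  have hdec : ∀ k, (∀ᶠ n in atTop, (hankel (T n) k 0).det = 0) ∨
      (∀ᶠ n in atTop, (hankel (T n) k 0).det ≠ 0) := fun k => (hankel_ev hT k 0).det.zero_or
  have hdec' : ∀ᶠ n in atTop, ∀ k ∈ Finset.range (N + 1),
      ((hankel (T n) k 0).det ≠ 0 ↔ ∀ᶠ n in atTop, (hankel (T n) k 0).det ≠ 0) := by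
    rw [Filter.eventually_all_finset]
    intro k _
    rcases hdec k with h | h
    · have h' : ¬ ∀ᶠ n in atTop, (hankel (T n) k 0).det ≠ 0 := fun h2 => by
        obtain ⟨n, h3, h4⟩ := (h.and h2).exists
        exact h4 h3
      filter_upwards [h] with n hn
      simp [hn, h']
    · filter_upwards [h] with n hn
      exact ⟨fun _ => h, fun _ => hn⟩
  classical
  let S := (Finset.range (N + 1)).filter fun k => ∀ᶠ n in atTop, (hankel (T n) k 0).det ≠ 0
  refine ⟨S.sup id, ?_⟩
  filter_upwards [hdec', hN] with n h1 h2
  apply le_antisymm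
  · have : (ev n).card ∈ S := Finset.mem_filter.2 ⟨Finset.mem_range.2 (by omega),
      (h1 _ (Finset.mem_range.2 (by omega))).1 (hn n)⟩
    exact Finset.le_sup (f := id) this
  · refine Finset.sup_le fun k hk => ?_
    obtain ⟨h3, h4⟩ := Finset.mem_filter.1 hk
    by_contra h5
    exact (h1 k h3).2 h4 (hz n k (by simpa using h5))

theorem hankel_main (ev : ℕ → Finset ℂ) (mu : ℕ → ℂ → ℕ) (hmu : ∀ n, ∀ z ∈ ev n, mu n z ≠ 0)
    (N : ℕ) (hN : ∀ᶠ n in atTop, (ev n).card ≤ N) (T : ℕ → ℕ → ℚ)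
    (hT : ∀ k, EvRat (fun n => T n k))
    (hTr : ∀ n k, (T n k : ℂ) = ∑ z ∈ ev n, (mu n z : ℂ) * z ^ k) :
    ∃ (s : ℕ) (P : ℚ[X][X]) (f : Fin s → ℕ → ℂ) (q : Fin s → ℚ[X]), P ≠ 0 ∧ ∀ᶠ n : ℕ in atTop,
      (∀ i, aeval (f i n) (P.map (evalRingHom (n : ℚ))) = 0) ∧
      Function.Injective (fun i => f i n) ∧ (∀ μ, μ ∈ ev n ↔ ∃ i, f i n = μ) ∧
      ∀ i, (q i).eval (n : ℚ) = (mu n (f i n) : ℚ) := by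
  classical
  obtain ⟨s, hs⟩ := card_const ev mu hmu N hN T hT hTr
  have hex : ∀ n, ∃ g : Fin s → ℂ, (ev n).card = s → Function.Injective g ∧
      (∀ a, mu n (g a) ≠ 0) ∧ (∀ μ, μ ∈ ev n ↔ ∃ i, g i = μ) ∧
      ∀ k, (T n k : ℂ) = ∑ a, (mu n (g a) : ℂ) * g a ^ k := by
    intro n
    by_cases h : (ev n).card = s
    · let e := (ev n).equivFinOfCardEq h
      refine ⟨fun a => (e.symm a : ev n), fun _ =>
        ⟨fun a b h => e.symm.injective (Subtype.ext h), fun a => hmu n _ (Subtype.mem _),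
        fun μ => ⟨fun hμ => ⟨e ⟨μ, hμ⟩, by simp⟩, ?_⟩, fun k => ?_⟩⟩
      · rintro ⟨i, rfl⟩; exact Subtype.mem _
      · rw [hTr, sum_enum (ev n) e]
    · exact ⟨0, fun h' => absurd h' h⟩
  choose g hg using hex
  obtain ⟨P, c, hP, hc, hPc⟩ := clear_denoms s (fun n => (compM (T n) s).charpoly)
    (Eventually.of_forall fun n => by rw [Matrix.charpoly_natDegree_eq_dim]; simp)
    (Eventually.of_forall fun n => (Matrix.charpoly_monic _).ne_zero)
    (fun k => (compM_ev hT s).charpoly k)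
  obtain ⟨q, hq⟩ := claimB s (fun n => (multM (T n) s).charpoly)
    (fun n => Finset.univ.val.map fun a : Fin s => (mu n (g n a) : ℤ))
    (fun k => (multM_ev hT s).charpoly k) (by
      filter_upwards [hs] with n hn
      obtain ⟨h1, h2, h3, h4⟩ := hg n hn
      refine ⟨by simp, ?_⟩
      rw [multM_charpoly h4 h1 h2, Multiset.map_map, Finset.prod]
      simp)
  have hex2 : ∀ n, ∃ σ : Equiv.Perm (Fin s), (ev n).card = s →
      (multM (T n) s).charpoly = ∏ i, (X - C ((q i).eval (n : ℚ))) →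
      ∀ i, (mu n (g n (σ i)) : ℚ) = (q i).eval (n : ℚ) := by
    intro n
    by_cases h : (ev n).card = s ∧
      (multM (T n) s).charpoly = ∏ i, (X - C ((q i).eval (n : ℚ)))
    · obtain ⟨h1, h2, h3, h4⟩ := hg n h.1
      have h5 := h.2
      rw [multM_charpoly h4 h1 h2] at h5
      obtain ⟨σ, hσ⟩ := perm_of_prod_eq _ _ h5
      exact ⟨σ, fun _ _ => hσ⟩
    · exact ⟨1, fun h1 h2 => absurd ⟨h1, h2⟩ h⟩
  choose σ hσ using hex2
  refine ⟨s, P, fun i n => g n (σ n i), q, hP, ?_⟩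
  filter_upwards [hs, hPc, hq] with n hn h1 h2
  obtain ⟨h3, h4, h5, h6⟩ := hg n hn
  refine ⟨fun i => ?_, h3.comp (σ n).injective, fun μ => ?_, fun i => (hσ n hn h2 i).symm⟩
  · rw [h1, map_mul, aeval_def (g n (σ n i)) (compM (T n) s).charpoly, eval₂_eq_eval_map,
      compM_charpoly h6 h3 (fun a => Nat.cast_ne_zero.2 (h4 a)), eval_prod,
      Finset.prod_eq_zero (Finset.mem_univ (σ n i)) (by simp), mul_zero]
  · rw [h5]
    exact ⟨fun ⟨i, hi⟩ => ⟨(σ n).symm i, by simpa using hi⟩, fun ⟨i, hi⟩ => ⟨_, hi⟩⟩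

theorem final_aux (X : FISet) (hX : X.FG)
    (R : ∀ n, Set ((X.prod X).obj n)) (hR : (X.prod X).IsFISubset R) :
    ∃ (n₀ s : ℕ) (P : Fin s → Polynomial (Polynomial ℚ)) (f : Fin s → ℕ → ℂ)
      (q : Fin s → Polynomial ℚ),
      (∀ i, P i ≠ 0) ∧
      ∀ n : ℕ, n₀ ≤ n →
        (∀ i, Polynomial.aeval (f i n) ((P i).map (Polynomial.evalRingHom (n : ℚ))) = 0) ∧
        Function.Injective (fun i : Fin s => f i n) ∧
        (∀ μ : ℂ, (relEnd X R n).HasEigenvalue μ ↔ ∃ i, f i n = μ) ∧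
        (∀ i, (q i).eval (n : ℚ) =
          (Module.finrank ℂ ((relEnd X R n).maxGenEigenspace (f i n)) : ℚ)) := by
  obtain ⟨d, hd⟩ := hX
  obtain ⟨ev, N, h1, h2, h3⟩ := eig_data hd hR
  obtain ⟨s, P, f, q, hP, h⟩ := hankel_main ev
    (fun n μ => Module.finrank ℂ ((relEnd X R n).maxGenEigenspace μ))
    (fun n z hz => by
      rw [Ne, Submodule.finrank_eq_zero]
      exact (gen_ne_bot_iff _ _).2 ((h1 n z).1 hz)) N h2
    (fun n k => (Nat.card (closedWalks X R k n) : ℚ)) (fun k => trace_evRat hd hR k) h3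
  obtain ⟨n₀, hn₀⟩ := eventually_atTop.1 h
  refine ⟨n₀, s, fun _ => P, f, q, fun _ => hP, fun n hn => ?_⟩
  obtain ⟨a, b, c, e⟩ := hn₀ n hn
  exact ⟨a, b, fun μ => (h1 n μ).symm.trans (c μ), e⟩
end PE2

end Helpers

/-- **Statement 2** (Corollary C): for a finitely generated `FI`-set `X` and an `FI`-subset
`R ⊆ X × X` with induced maps `r_n`, eventually: the distinct eigenvalues of `r_n` are the
values `f₁(n), …, f_s(n)` of finitely many functions algebraic over `ℚ(n)` (each being a
root of a fixed nonzero `P_i ∈ ℚ[t][z]` evaluated at `t = n`), and the algebraic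
multiplicity of `f_i(n)` is given by a polynomial `q_i ∈ ℚ[t]`. -/
theorem statement2 (X : FISet) (hX : X.FG)
    (R : ∀ n, Set ((X.prod X).obj n)) (hR : (X.prod X).IsFISubset R) :
    ∃ (n₀ s : ℕ) (P : Fin s → Polynomial (Polynomial ℚ)) (f : Fin s → ℕ → ℂ)
      (q : Fin s → Polynomial ℚ),
      (∀ i, P i ≠ 0) ∧
      ∀ n : ℕ, n₀ ≤ n →
        (∀ i, Polynomial.aeval (f i n) ((P i).map (Polynomial.evalRingHom (n : ℚ))) = 0) ∧
        Function.Injective (fun i : Fin s => f i n) ∧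
        (∀ μ : ℂ, (relEnd X R n).HasEigenvalue μ ↔ ∃ i, f i n = μ) ∧
        (∀ i, (q i).eval (n : ℚ) =
          (Module.finrank ℂ ((relEnd X R n).maxGenEigenspace (f i n)) : ℚ)) := by
  exact final_aux X hX R hR
end

section
/- Let X be a finitely generated FI-set. Then there exists N such that for all n ≥ N and every injection f : [n] → [n+1], the transition map f_* : X_n → X_{n+1} is injective. -/
theorem fi_extend {k m n : ℕ} (hmn : m ≤ n) (e : Fin k ↪ Fin m) (e' : Fin k ↪ Fin n) :
    ∃ g : Fin m ↪ Fin n, e.trans g = e' := by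
  obtain ⟨σ, hσ⟩ := Equiv.Perm.exists_extending_pair (e.trans (Fin.castLEEmb hmn)) e'
    (Function.Embedding.injective _) e'.injective
  refine ⟨(Fin.castLEEmb hmn).trans σ.toEmbedding, ?_⟩
  ext i
  have := hσ i
  simpa using congrArg Fin.val this

theorem fi_factor {k p n : ℕ} (e : Fin k ↪ Fin n) (f : Fin p ↪ Fin n)
    (h : ∀ i, ∃ j, e j = f i) : ∃ f' : Fin p ↪ Fin k, f'.trans e = f := by
  choose F hF using h
  refine ⟨⟨F, fun a b hab => f.injective ?_⟩, ?_⟩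
  · rw [← hF a, ← hF b, hab]
  · ext i
    exact congrArg Fin.val (hF i)

theorem fi_transfer (X : FISet) {k m n : ℕ} (hmn : m ≤ n) (e : Fin k ↪ Fin m)
    (e' : Fin k ↪ Fin n) (x y : X.obj k) (h : X.map e x = X.map e y) :
    X.map e' x = X.map e' y := by
  obtain ⟨g, rfl⟩ := fi_extend hmn e e'
  rw [X.map_comp, X.map_comp, h]

theorem fi_pair (X : FISet) {d : ℕ} (hd : X.FGDeg d) {n : ℕ} (hn : 2 * d ≤ n)
    (x y : X.obj n) : ∃ (h : Fin (2 * d) ↪ Fin n) (a b : X.obj (2 * d)),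
      X.map h a = x ∧ X.map h b = y := by
  obtain ⟨p, hp, f, a, rfl⟩ := hd n x
  obtain ⟨q, hq, g, b, rfl⟩ := hd n y
  have hc : (Finset.univ.map f ∪ Finset.univ.map g).card ≤ 2 * d := by
    refine (Finset.card_union_le _ _).trans ?_
    simp
    omega
  obtain ⟨T, hT, hTc⟩ := Finset.exists_superset_card_eq hc (by simpa using hn)
  have hr := Finset.range_orderEmbOfFin T hTc
  have key : ∀ i ∈ T, ∃ j, (T.orderEmbOfFin hTc).toEmbedding j = i := by
    intro i hi
    have : i ∈ Set.range (T.orderEmbOfFin hTc) := by rw [hr]; exact hi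
    exact this
  obtain ⟨f', hf⟩ := fi_factor (T.orderEmbOfFin hTc).toEmbedding f
    (fun i => key _ (hT (by simp)))
  obtain ⟨g', hg⟩ := fi_factor (T.orderEmbOfFin hTc).toEmbedding g
    (fun i => key _ (hT (by simp)))
  refine ⟨(T.orderEmbOfFin hTc).toEmbedding, X.map f' a, X.map g' b, ?_, ?_⟩
  · rw [← X.map_comp, hf]
  · rw [← X.map_comp, hg]

/-- **Statement 4**: for a finitely generated `FI`-set `X`, all transition maps
`X_n → X_{n+1}` are injective once `n` is sufficiently large. -/
theorem statement4 (X : FISet) (hX : X.FG) :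
    ∃ N : ℕ, ∀ n : ℕ, N ≤ n → ∀ f : Fin n ↪ Fin (n + 1),
      Function.Injective (X.map f) := by
  obtain ⟨d, hd⟩ := hX
  have hM : ∀ z : X.obj (2 * d) × X.obj (2 * d), ∃ M : ℕ,
      (∃ (m : ℕ) (e : Fin (2 * d) ↪ Fin m), X.map e z.1 = X.map e z.2) →
      ∃ e : Fin (2 * d) ↪ Fin M, X.map e z.1 = X.map e z.2 := by
    intro z
    by_cases h : ∃ (m : ℕ) (e : Fin (2 * d) ↪ Fin m), X.map e z.1 = X.map e z.2
    · obtain ⟨m, hm⟩ := h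
      exact ⟨m, fun _ => hm⟩
    · exact ⟨0, fun h' => absurd h' h⟩
  choose M hM using hM
  refine ⟨max (2 * d) (Finset.univ.sup M), fun n hn f x y hxy => ?_⟩
  obtain ⟨h, a, b, rfl, rfl⟩ := fi_pair X hd ((le_max_left _ _).trans hn) x y
  rw [← X.map_comp, ← X.map_comp] at hxy
  obtain ⟨e, he⟩ := hM (a, b) ⟨_, _, hxy⟩
  refine fi_transfer X ?_ e h a b he
  exact (Finset.le_sup (f := M) (Finset.mem_univ (a, b))).trans ((le_max_right _ _).trans hn)
end

section
/- Let X be a finitely generated FI-set. Then there exists N such that the number of orbits of S_n acting on X_n is the same for all n ≥ N. -/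
theorem FISet.card_orbits_succ_le (X : FISet) {d : ℕ} (hd : X.FGDeg d) (n : ℕ) (hn : d ≤ n) :
    Nat.card (MulAction.orbitRel.Quotient (Equiv.Perm (Fin (n+1))) (X.obj (n+1))) ≤
    Nat.card (MulAction.orbitRel.Quotient (Equiv.Perm (Fin n)) (X.obj n)) := by
  classical
  have hsurj : Function.Surjective
      (fun q : MulAction.orbitRel.Quotient (Equiv.Perm (Fin n)) (X.obj n) =>
        (Quotient.mk (MulAction.orbitRel (Equiv.Perm (Fin (n+1))) (X.obj (n+1)))
          (X.map Fin.castSuccEmb (Quotient.out q)))) := by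
    intro q
    induction q using Quotient.inductionOn with
    | h x =>
    obtain ⟨m, hm, f, y, rfl⟩ := hd _ x
    let g : Fin m ↪ Fin n := (Fin.castLEEmb (hm.trans hn))
    refine ⟨Quotient.mk _ (X.map g y), ?_⟩
    apply Quotient.sound
    obtain ⟨τ, hτ⟩ : ∃ τ : Equiv.Perm (Fin n), τ • X.map g y =
        Quotient.out (Quotient.mk (MulAction.orbitRel (Equiv.Perm (Fin n)) (X.obj n))
          (X.map g y)) := by
      have h := Quotient.mk_out (s := MulAction.orbitRel (Equiv.Perm (Fin n)) (X.obj n))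
        (X.map g y)
      exact h
    have ht := Equiv.Perm.isMultiplyPretransitive (Fin (n+1)) m
    obtain ⟨σ, hσ⟩ := ht.exists_smul_eq f ((g.trans τ.toEmbedding).trans Fin.castSuccEmb)
    refine ⟨σ, ?_⟩
    have h2 : f.trans σ.toEmbedding = (g.trans τ.toEmbedding).trans Fin.castSuccEmb := by
      rw [← hσ]; ext i; rfl
    change σ • X.map f y = X.map Fin.castSuccEmb (Quotient.out _)
    rw [← hτ, FISet.smul_def, FISet.smul_def, ← X.map_comp, ← X.map_comp, ← X.map_comp, h2]; rfl
  exact Nat.card_le_card_of_surjective _ hsurj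

/-- **Statement 5**: for a finitely generated `FI`-set `X`, the number of orbits of `S_n`
acting on `X_n` is eventually constant. -/
theorem statement5 (X : FISet) (hX : X.FG) :
    ∃ (N c : ℕ), ∀ n : ℕ, N ≤ n →
      Nat.card (MulAction.orbitRel.Quotient (Equiv.Perm (Fin n)) (X.obj n)) = c := by
  obtain ⟨d, hd⟩ := hX
  let a : ℕ → ℕ := fun k =>
    Nat.card (MulAction.orbitRel.Quotient (Equiv.Perm (Fin (d+k))) (X.obj (d+k)))
  have ha : Antitone a := antitone_nat_of_succ_le fun k =>
    X.card_orbits_succ_le hd (d+k) (Nat.le_add_right _ _)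
  obtain ⟨k, hk⟩ : ∃ k, ∀ j, a k ≤ a j := by
    exact ⟨Function.argmin a, fun j => Function.argmin_le a j⟩
  refine ⟨d + k, a k, fun n hn => ?_⟩
  obtain ⟨j, rfl⟩ : ∃ j, n = d + (k + j) := ⟨n - (d + k), by omega⟩
  exact le_antisymm (ha (Nat.le_add_right k j)) (hk (k + j))
end

section
/- Let X and Y be finitely generated FI-sets. Then every FI-subset R of the product FI-set X × Y (defined by (X × Y)_n = X_n × Y_n with the diagonal transition maps) is a finitely generated FI-set. -/
theorem FISet.exists_perm_extend {m n : ℕ} (h : m ≤ n) (f : Fin m ↪ Fin n) :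
    ∃ σ : Equiv.Perm (Fin n), (Fin.castLEEmb h).trans σ.toEmbedding = f := by
  have := Equiv.Perm.isMultiplyPretransitive (Fin n) m
  obtain ⟨σ, hσ⟩ := this.exists_smul_eq (Fin.castLEEmb h) f
  refine ⟨σ, ?_⟩
  rw [← hσ]
  ext i
  simp [Function.Embedding.smul_apply]

theorem FISet.fg_sub (Z : FISet) (hZ : Z.FG) (R : ∀ n, Set (Z.obj n))
    (hR : Z.IsFISubset R) : (Z.subFISet R hR).FG := by
  classical
  obtain ⟨D, hD⟩ := hZ
  let P : (Σ m : Fin (D + 1), Z.obj m) → ℕ → Prop := fun p n =>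
    ∃ h : p.1.1 ≤ n, Z.map (Fin.castLEEmb h) p.2 ∈ R n
  let N : (Σ m : Fin (D + 1), Z.obj m) → ℕ := fun p =>
    if h : ∃ n, P p n then Nat.find h else 0
  refine ⟨Finset.univ.sup N, ?_⟩
  rintro n ⟨x, hx⟩
  obtain ⟨m, hm, f, z, rfl⟩ := hD n x
  have hmn : m ≤ n := by simpa using Fintype.card_le_of_embedding f
  obtain ⟨σ, hσ⟩ := FISet.exists_perm_extend hmn f
  let p : (Σ m : Fin (D + 1), Z.obj m) := ⟨⟨m, by omega⟩, z⟩
  have hPn : P p n := by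
    refine ⟨hmn, ?_⟩
    have h1 := hR σ.symm.toEmbedding _ hx
    rw [← Z.map_comp] at h1
    convert h1 using 2
    rw [← hσ]
    ext i
    simp
  have hex : ∃ n, P p n := ⟨n, hPn⟩
  have hN : N p = Nat.find hex := dif_pos hex
  have hPN : P p (N p) := by rw [hN]; exact Nat.find_spec hex
  have hle : N p ≤ n := by rw [hN]; exact Nat.find_min' hex hPn
  obtain ⟨h2, h3⟩ := hPN
  refine ⟨N p, Finset.le_sup (Finset.mem_univ p), (Fin.castLEEmb hle).trans σ.toEmbedding,
    ⟨_, h3⟩, ?_⟩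
  apply Subtype.ext
  show Z.map _ (Z.map _ z) = Z.map f z
  rw [← Z.map_comp]
  congr 1

theorem FISet.exists_factor {a k n : ℕ} (f : Fin a ↪ Fin n) (e : Fin k ↪ Fin n)
    (h : ∀ i, ∃ j, e j = f i) : ∃ f' : Fin a ↪ Fin k, f'.trans e = f := by
  choose g hg using h
  refine ⟨⟨g, fun i j hij => f.injective ?_⟩, ?_⟩
  · rw [← hg i, ← hg j, hij]
  · ext i
    exact congrArg Fin.val (hg i)

theorem FISet.fg_prod (X Y : FISet) (hX : X.FG) (hY : Y.FG) : (X.prod Y).FG := by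
  classical
  obtain ⟨d, hd⟩ := hX
  obtain ⟨e, he⟩ := hY
  refine ⟨d + e, ?_⟩
  rintro n ⟨x, y⟩
  obtain ⟨a, ha, f, x, rfl⟩ := hd n x
  obtain ⟨b, hb, g, y, rfl⟩ := he n y
  let S : Finset (Fin n) := Finset.univ.map f ∪ Finset.univ.map g
  have hS : S.card ≤ d + e := by
    refine (Finset.card_union_le _ _).trans ?_
    simp
    omega
  let ι : Fin S.card ↪ Fin n := (S.orderEmbOfFin rfl).toEmbedding
  have hι : ∀ s ∈ S, ∃ j, ι j = s := by
    intro s hs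
    have : s ∈ Set.range (S.orderEmbOfFin rfl) := by
      rw [Finset.range_orderEmbOfFin]; exact hs
    exact this
  obtain ⟨f', hf⟩ := FISet.exists_factor f ι (fun i => hι _ (by simp [S]))
  obtain ⟨g', hg⟩ := FISet.exists_factor g ι (fun i => hι _ (by simp [S]))
  refine ⟨S.card, hS, ι, (X.map f' x, Y.map g' y), ?_⟩
  show (X.map ι (X.map f' x), Y.map ι (Y.map g' y)) = _
  rw [← X.map_comp, ← Y.map_comp, hf, hg]

/-- **Statement 8**: every `FI`-subset (relation) of the product of two finitely generated
`FI`-sets is itself a finitely generated `FI`-set. -/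
theorem statement8 (X Y : FISet) (hX : X.FG) (hY : Y.FG)
    (R : ∀ n, Set ((X.prod Y).obj n)) (hR : (X.prod Y).IsFISubset R) :
    ((X.prod Y).subFISet R hR).FG := 
  FISet.fg_sub _ (FISet.fg_prod X Y hX hY) R hR
end

section
/- Let X be an FI-set, k ≥ 0, x ∈ X_k, for m ≥ k let G_m ≤ S_m denote the stabilizer of (ι_{k,m})_*(x), and for n ≥ k let A_n ⊆ [n] denote the orbit of the point n under G_n. Then for every n > k, A_{n+1} ⊇ A_n ∪ {n+1}. -/
/-- The stabilizer `G_n ≤ S_n` of the image of `x ∈ X_k` under the standard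
inclusion `ι_{k,n} : [k] → [n]`. -/
def FISet.stab (X : FISet) {k : ℕ} (x : X.obj k) (n : ℕ) (h : k ≤ n) :
    Subgroup (Equiv.Perm (Fin n)) :=
  MulAction.stabilizer (Equiv.Perm (Fin n)) (X.map (Fin.castLEEmb h) x)
/-- `A_n ⊆ [n]`: the orbit of the last point `n ∈ [n]` under `G_n`. -/
def FISet.orbA (X : FISet) {k : ℕ} (x : X.obj k) (n : ℕ) (h : k ≤ n) (h0 : 0 < n) :
    Set (Fin n) :=
  MulAction.orbit (X.stab x n h) (⟨n - 1, by omega⟩ : Fin n)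
/-- **Statement 10**: for `n > k` we have `A_{n+1} ⊇ A_n ∪ {n+1}` (where `A_n` is viewed
inside `[n+1]` via the standard inclusion). -/
theorem statement10 (X : FISet) (k : ℕ) (x : X.obj k) (n : ℕ) (hn : k < n) :
    ((⟨n, by omega⟩ : Fin (n + 1)) ∈ X.orbA x (n + 1) (by omega) (by omega)) ∧
    (∀ a : Fin n, a ∈ X.orbA x n hn.le (by omega) →
      a.castSucc ∈ X.orbA x (n + 1) (by omega) (by omega)) := by
  refine ⟨MulAction.mem_orbit_self _, ?_⟩
  rintro a ⟨⟨σ, hσ⟩, rfl⟩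
  have hσ' : X.map σ.toEmbedding (X.map (Fin.castLEEmb hn.le) x)
      = X.map (Fin.castLEEmb hn.le) x := hσ
  let c : Fin n ↪ Fin (n + 1) := ⟨Fin.castSucc, Fin.castSucc_injective n⟩
  let p : Fin n := ⟨n - 1, by omega⟩
  let s : Equiv.Perm (Fin (n + 1)) := Equiv.swap (c p) (Fin.last n)
  let t : Equiv.Perm (Fin (n + 1)) := σ.viaEmbedding c
  have ht : ∀ i, t (c i) = c (σ i) := fun i => Equiv.Perm.viaEmbedding_apply σ c i
  have hk : k ≤ n + 1 := by omega
  have e1 : Fin.castLEEmb hk = (Fin.castLEEmb hn.le).trans c := by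
    ext i; rfl
  have e2 : (Fin.castLEEmb hk).trans s.toEmbedding = Fin.castLEEmb hk := by
    apply Function.Embedding.ext
    intro i
    show Equiv.swap (c p) (Fin.last n) (Fin.castLE hk i) = Fin.castLE hk i
    have := i.2
    apply Equiv.swap_apply_of_ne_of_ne
    · intro h
      have h' : (i : ℕ) = n - 1 := congrArg Fin.val h
      omega
    · intro h
      have h' : (i : ℕ) = n := congrArg Fin.val h
      omega
  have e3 : c.trans t.toEmbedding = σ.toEmbedding.trans c := by
    apply Function.Embedding.ext
    intro i
    exact ht i
  have hs : s ∈ X.stab x (n + 1) hk := by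
    show X.map s.toEmbedding (X.map (Fin.castLEEmb hk) x) = X.map (Fin.castLEEmb hk) x
    rw [← X.map_comp, e2]
  have htm : t ∈ X.stab x (n + 1) hk := by
    show X.map t.toEmbedding (X.map (Fin.castLEEmb hk) x) = X.map (Fin.castLEEmb hk) x
    rw [e1, X.map_comp, ← X.map_comp c, e3, X.map_comp, hσ']
  refine ⟨⟨t * s, mul_mem htm hs⟩, ?_⟩
  show t (Equiv.swap (c p) (Fin.last n) (Fin.last n)) = c (σ p)
  rw [Equiv.swap_apply_right, ht]
end

section
/- Let X be an FI-set, k ≥ 0, x ∈ X_k, for m ≥ k let G_m ≤ S_m denote the stabilizer of (ι_{k,m})_*(x), and for n ≥ k let A_n ⊆ [n] denote the orbit of the point n under G_n. Suppose n > k and 2(n−k) > |A_n|. Then S_{A_n} ⊆ G_n, where S_{A_n} denotes the subgroup of S_n consisting of permutations fixing every element of [n] \ A_n. -/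
theorem FISet.swap_mem_stab_aux (X : FISet) {k : ℕ} (x : X.obj k) (n : ℕ) (h : k ≤ n)
    (i j : Fin n) (hi : k ≤ i.val) (hj : k ≤ j.val) : Equiv.swap i j ∈ X.stab x n h := by
  unfold FISet.stab
  rw [MulAction.mem_stabilizer_iff, FISet.smul_def, ← X.map_comp]
  congr 1
  ext a
  have h1 : Fin.castLE h a ≠ i := by
    intro e; have := a.2; rw [← e] at hi; simp at hi; omega
  have h2 : Fin.castLE h a ≠ j := by
    intro e; have := a.2; rw [← e] at hj; simp at hj; omega
  simp [Equiv.swap_apply_of_ne_of_ne h1 h2]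

/-- **Statement 11** (Key Lemma): if `n > k` and `2(n-k) > |A_n|`, then `S_{A_n} ⊆ G_n`,
where `S_{A_n}` is the set of permutations of `[n]` fixing every element of `[n] \ A_n`. -/
theorem statement11 (X : FISet) (k : ℕ) (x : X.obj k) (n : ℕ) (hn : k < n)
    (hcard : (X.orbA x n hn.le (by omega)).ncard < 2 * (n - k)) :
    ∀ σ : Equiv.Perm (Fin n),
      (∀ i : Fin n, i ∉ X.orbA x n hn.le (by omega) → σ i = i) →
      σ ∈ X.stab x n hn.le := by
  classical
  intro σ hσ
  set A := X.orbA x n hn.le (by omega) with hA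
  set G := X.stab x n hn.le with hG
  have hB := X.swap_mem_stab_aux x n hn.le
  set l : Fin n := ⟨n - 1, by omega⟩ with hl
  have hlk : k ≤ l.val := by simp [hl]; omega
  have hAdef : A = MulAction.orbit G l := rfl
  have hgA : ∀ g ∈ G, ∀ i : Fin n, k ≤ i.val → g i ∈ A := by
    intro g hg i hi
    rw [hAdef]
    refine ⟨⟨g * Equiv.swap l i, G.mul_mem hg (hB l i hlk hi)⟩, ?_⟩
    simp [Subgroup.smul_def]
  have hlast : ∀ a ∈ A, Equiv.swap a l ∈ G := by
    intro a ha
    rw [hAdef] at ha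
    obtain ⟨⟨g, hg⟩, rfl⟩ := ha
    show Equiv.swap (g l) l ∈ G
    let B : Finset (Fin n) := Finset.univ.filter (fun i => k ≤ i.val)
    have hBc : B.card = n - k := by
      have : B = Finset.Ici (⟨k, hn⟩ : Fin n) := by
        ext i; simp [B, Fin.le_def]
      rw [this, Fin.card_Ici]
    have hne : ¬ Disjoint B (B.image g) := by
      intro hd
      have h1 : (B ∪ B.image g).card = 2 * (n - k) := by
        rw [Finset.card_union_of_disjoint hd, Finset.card_image_of_injective _ g.injective, hBc]
        omega
      have h2 : ((B ∪ B.image g : Finset (Fin n)) : Set (Fin n)) ⊆ A := by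
        intro i hi
        simp only [Finset.coe_union, Set.mem_union, Finset.mem_coe, Finset.mem_image] at hi
        rcases hi with hi | ⟨j, hj, rfl⟩
        · simpa using hgA 1 G.one_mem i (Finset.mem_filter.1 hi).2
        · exact hgA g hg j (Finset.mem_filter.1 hj).2
      have h3 := Set.ncard_le_ncard h2 (Set.toFinite _)
      rw [Set.ncard_coe_finset, h1] at h3
      omega
    obtain ⟨b, hb1, hb2⟩ := Finset.not_disjoint_iff.1 hne
    obtain ⟨j, hj, rfl⟩ := Finset.mem_image.1 hb2
    have e1 : Equiv.swap (g l) (g j) ∈ G := by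
      rw [Equiv.swap_apply_apply]
      exact G.mul_mem (G.mul_mem hg (hB l j hlk (Finset.mem_filter.1 hj).2)) (G.inv_mem hg)
    exact SubmonoidClass.swap_mem_trans G e1 (hB _ _ (Finset.mem_filter.1 hb1).2 hlk)
  have hall : ∀ a ∈ A, ∀ b ∈ A, Equiv.swap a b ∈ G := by
    intro a ha b hb
    refine SubmonoidClass.swap_mem_trans G (hlast a ha) ?_
    rw [Equiv.swap_comm]; exact hlast b hb
  let S : Set (Equiv.Perm (Fin n)) := {f | f.IsSwap ∧ f ∈ G}
  have hS : Subgroup.closure S ≤ G := (Subgroup.closure_le _).2 fun f hf => hf.2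
  apply hS
  rw [mem_closure_isSwap (fun f hf => hf.1)]
  refine ⟨Set.toFinite _, fun i => ?_⟩
  by_cases hi : σ i = i
  · rw [hi]; exact MulAction.mem_orbit_self i
  · have hiA : i ∈ A := by
      by_contra h; exact hi (hσ i h)
    have hsA : σ i ∈ A := by
      by_contra h; exact hi (σ.injective (hσ _ h))
    refine ⟨⟨Equiv.swap i (σ i), Subgroup.subset_closure
      ⟨⟨i, σ i, fun e => hi e.symm, rfl⟩, hall _ hiA _ hsA⟩⟩, ?_⟩
    simp [Subgroup.smul_def]
end
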